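/- arXiv:2301.04264 — 2 statements merged into one kernel-verified Lean document; each statement's English description precedes it below -/
import Mathlib

section
/- Let r be a nonnegative integer and A a definable closed subset of ℝⁿ. Then there exists a definable C^r function f: ℝⁿ → ℝ with f⁻¹(0) = A. -/
open FirstOrder Set Topology

namespace Paper

variable (L : FirstOrder.Language) [L.Structure ℝ]

/-- A subset of `ℝⁿ` is definable in the structure (with parameters from `ℝ`). -/
def Def (n : ℕ) (s : Set (Fin n → ℝ)) : Prop :=
  Set.Definable (Set.univ : Set ℝ) L s

/-- A subset of `ℝ` is definable. -/
def Def1 (s : Set ℝ) : Prop := Def L 1 {x | x 0 ∈ s}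

/-- The structure expands the ordered field `(ℝ, <, +, ·, 0, 1)`:
the order and the field operations (and the constants) are definable. -/
def ExpandsOrderedField : Prop :=
  Def L 2 {x | x 0 < x 1} ∧ Def L 3 {x | x 0 + x 1 = x 2} ∧
  Def L 3 {x | x 0 * x 1 = x 2} ∧ Def L 1 {x | x 0 = 0} ∧ Def L 1 {x | x 0 = 1}

/-- Local o-minimality: every definable subset of `ℝ` is, near each point, a finite
union of points and open intervals. -/
def LocallyOMinimal : Prop :=
  ∀ X : Set ℝ, Def1 L X → ∀ a : ℝ,
    ∃ b c : ℝ, b < a ∧ a < c ∧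
      ∃ (P : Finset ℝ) (J : Finset (ℝ × ℝ)),
        X ∩ Set.Ioo b c = ↑P ∪ ⋃ p ∈ J, Set.Ioo p.1 p.2

/-- First component of a point of `ℝ^(m+n) = ℝ^m × ℝ^n`. -/
def fstFun {m n : ℕ} (z : Fin (m + n) → ℝ) : Fin m → ℝ := fun i => z (Fin.castAdd n i)

/-- Second component of a point of `ℝ^(m+n) = ℝ^m × ℝ^n`. -/
def sndFun {m n : ℕ} (z : Fin (m + n) → ℝ) : Fin n → ℝ := fun j => z (Fin.natAdd m j)

/-- The map `f : X → ℝⁿ`, `X ⊆ ℝ^m`, is definable (its graph over `X` is definable). -/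
def DefMapOn (m n : ℕ) (X : Set (Fin m → ℝ)) (f : (Fin m → ℝ) → (Fin n → ℝ)) : Prop :=
  Def L (m + n) {z | fstFun z ∈ X ∧ sndFun z = f (fstFun z)}

/-- The function `f : X → ℝ`, `X ⊆ ℝ^m`, is definable. -/
def DefFunOn (m : ℕ) (X : Set (Fin m → ℝ)) (f : (Fin m → ℝ) → ℝ) : Prop :=
  DefMapOn L m 1 X fun x _ => f x

/-- `f` is of class `C^r` on `X` in the sense that near every point of `X` it agrees on `X`
with a `C^r` map defined on an open neighborhood in the ambient space. -/
def CrMapOn (r m n : ℕ) (X : Set (Fin m → ℝ)) (f : (Fin m → ℝ) → (Fin n → ℝ)) : Prop :=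
  ∀ a ∈ X, ∃ (W : Set (Fin m → ℝ)) (g : (Fin m → ℝ) → (Fin n → ℝ)),
    a ∈ W ∧ IsOpen W ∧ ContDiffOn ℝ r g W ∧ Set.EqOn f g (X ∩ W)

/-- Real-valued version of `CrMapOn`. -/
def CrFunOn (r m : ℕ) (X : Set (Fin m → ℝ)) (f : (Fin m → ℝ) → ℝ) : Prop :=
  ∀ a ∈ X, ∃ (W : Set (Fin m → ℝ)) (g : (Fin m → ℝ) → ℝ),
    a ∈ W ∧ IsOpen W ∧ ContDiffOn ℝ r g W ∧ Set.EqOn f g (X ∩ W)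

/-- A definable `C^r` map `X → ℝⁿ`. -/
def DefCrMapOn (r m n : ℕ) (X : Set (Fin m → ℝ)) (f : (Fin m → ℝ) → (Fin n → ℝ)) : Prop :=
  DefMapOn L m n X f ∧ CrMapOn r m n X f

/-- A definable `C^r` function `X → ℝ`. -/
def DefCrFunOn (r m : ℕ) (X : Set (Fin m → ℝ)) (f : (Fin m → ℝ) → ℝ) : Prop :=
  DefFunOn L m X f ∧ CrFunOn r m X f

/-- A definable `C^r` submanifold of `ℝⁿ` of dimension `d`: around every point there is a
definable `C^r` chart of `ℝⁿ` straightening `M` to the first `d` coordinates. -/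
def IsDefCrSubmanifold (r n d : ℕ) (M : Set (Fin n → ℝ)) : Prop :=
  Def L n M ∧
  ∀ a ∈ M, ∃ (U V : Set (Fin n → ℝ)) (φ ψ : (Fin n → ℝ) → (Fin n → ℝ)),
    a ∈ U ∧ IsOpen U ∧ Def L n U ∧
    (0 : Fin n → ℝ) ∈ V ∧ IsOpen V ∧ Def L n V ∧
    DefMapOn L n n U φ ∧ DefMapOn L n n V ψ ∧
    ContDiffOn ℝ r φ U ∧ ContDiffOn ℝ r ψ V ∧
    Set.BijOn φ U V ∧ Set.InvOn ψ φ U V ∧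
    φ a = 0 ∧
    φ '' (M ∩ U) = {x ∈ V | ∀ i : Fin n, d ≤ (i : ℕ) → x i = 0}

/-- The Euclidean norm on `ℝⁿ`. -/
noncomputable def eunorm {n : ℕ} (x : Fin n → ℝ) : ℝ := Real.sqrt (∑ i, x i ^ 2)

/-- Projection of `ℝⁿ` onto the `d` coordinates selected by `σ`. -/
def coordProj {n : ℕ} (d : ℕ) (σ : Fin d → Fin n) (x : Fin n → ℝ) : Fin d → ℝ :=
  fun i => x (σ i)

/-- `X ⊆ ℝⁿ` has dimension `d`: `d` is the largest integer such that some coordinate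
projection of `X` onto `ℝ^d` has nonempty interior. -/
def HasDim {n : ℕ} (X : Set (Fin n → ℝ)) (d : ℕ) : Prop :=
  (∃ σ : Fin d → Fin n, Function.Injective σ ∧ (interior (coordProj d σ '' X)).Nonempty) ∧
  ∀ (e : ℕ) (σ : Fin e → Fin n), Function.Injective σ →
    (interior (coordProj e σ '' X)).Nonempty → e ≤ d

/-- A (bounded) open box in `ℝⁿ`. -/
def IsOpenBox {n : ℕ} (B : Set (Fin n → ℝ)) : Prop :=
  ∃ a b : Fin n → ℝ, (∀ i, a i < b i) ∧ B = Set.pi Set.univ fun i => Set.Ioo (a i) (b i)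

end Paper

namespace Paper

universe u v

/-- A type of finite tuples of real numbers, identified with a power of `ℝ`. -/
class RealTuple (X : Type) where
  /-- The index type of the coordinates. -/
  Idx : Type
  finite : Finite Idx
  /-- The coordinates. -/
  coords : X ≃ (Idx → ℝ)

namespace RealTuple

attribute [instance] RealTuple.finite

instance : RealTuple ℝ := ⟨Unit, inferInstance, (Equiv.funUnique Unit ℝ).symm⟩

instance (n : ℕ) : RealTuple (Fin n → ℝ) := ⟨Fin n, inferInstance, Equiv.refl _⟩

instance (X Y : Type) [RealTuple X] [RealTuple Y] : RealTuple (X × Y) :=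
  ⟨Idx X ⊕ Idx Y, inferInstance,
    (Equiv.prodCongr coords coords).trans (Equiv.sumArrowEquivProdArrow _ _ _).symm⟩

end RealTuple

open RealTuple

section Definability

variable (L : FirstOrder.Language.{u, v}) [L.Structure ℝ]
variable {X Y Z : Type} [RealTuple X] [RealTuple Y] [RealTuple Z]

/-- A predicate on real tuples is definable with parameters. -/
@[fun_prop]
def DefPred (P : X → Prop) : Prop :=
  (univ : Set ℝ).Definable L {v | P (coords.symm v)}

/-- A set of real tuples is definable with parameters. -/
def DefSet (S : Set X) : Prop := DefPred L fun x => x ∈ S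

/-- A map between spaces of real tuples is definable with parameters. -/
@[fun_prop]
def DefMap (f : X → Y) : Prop :=
  (univ : Set ℝ).DefinableMap L fun v => coords (f (coords.symm v))

variable {L}

theorem DefPred.congr {P Q : X → Prop} (h : ∀ x, P x ↔ Q x) (hP : DefPred L P) : DefPred L Q := by
  have : P = Q := funext fun x => propext (h x)
  exact this ▸ hP

@[fun_prop]
theorem DefPred.and {P Q : X → Prop} (hP : DefPred L P) (hQ : DefPred L Q) :
    DefPred L fun x => P x ∧ Q x :=
  Definable.inter hP hQ

@[fun_prop]
theorem DefPred.or {P Q : X → Prop} (hP : DefPred L P) (hQ : DefPred L Q) :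
    DefPred L fun x => P x ∨ Q x :=
  Definable.union hP hQ

@[fun_prop]
theorem DefPred.not {P : X → Prop} (hP : DefPred L P) : DefPred L fun x => ¬ P x :=
  Definable.compl hP

@[fun_prop]
theorem DefPred.imp {P Q : X → Prop} (hP : DefPred L P) (hQ : DefPred L Q) :
    DefPred L fun x => P x → Q x :=
  (hP.not.or hQ).congr fun _ => imp_iff_not_or.symm

@[fun_prop]
theorem DefPred.iff {P Q : X → Prop} (hP : DefPred L P) (hQ : DefPred L Q) :
    DefPred L fun x => P x ↔ Q x :=
  ((hP.imp hQ).and (hQ.imp hP)).congr fun _ => iff_iff_implies_and_implies.symm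

@[fun_prop]
theorem DefPred.const (p : Prop) : DefPred L fun _ : X => p := by
  by_cases h : p
  · simp [DefPred, h]
  · simp [DefPred, h]

@[fun_prop]
theorem DefPred.exists {P : X → Y → Prop} (hP : DefPred L fun p : X × Y => P p.1 p.2) :
    DefPred L fun x => ∃ y, P x y := by
  unfold DefPred
  convert Definable.exists_of_finite hP using 1
  ext v
  constructor
  · rintro ⟨y, hy⟩
    refine ⟨coords y, ?_⟩
    change P (coords.symm v) (coords.symm (coords y))
    rwa [Equiv.symm_apply_apply]
  · rintro ⟨y, hy⟩
    exact ⟨coords.symm y, hy⟩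

@[fun_prop]
theorem DefPred.forall {P : X → Y → Prop} (hP : DefPred L fun p : X × Y => P p.1 p.2) :
    DefPred L fun x => ∀ y, P x y :=
  (DefPred.exists (P := fun x y => ¬ P x y) hP.not).not.congr fun _ => not_exists_not

@[fun_prop]
theorem DefPred.forall_finite {ι : Type*} [Finite ι] {P : X → ι → Prop}
    (hP : ∀ i, DefPred L fun x => P x i) : DefPred L fun x => ∀ i, P x i := by
  unfold DefPred
  simp only [ofPred_forall]
  exact definable_iInter_of_finite hP

theorem DefPred.comp {P : Y → Prop} (hP : DefPred L P) {f : X → Y} (hf : DefMap L f) :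
    DefPred L fun x => P (f x) := by
  have := Definable.preimage_map hf hP
  simpa [DefPred, preimage] using this

@[fun_prop]
theorem DefMap.id : DefMap L fun x : X => x := by
  intro i
  simp only [Equiv.apply_symm_apply]
  exact DefinableFun.proj L

@[fun_prop]
theorem DefMap.const (y : Y) : DefMap L fun _ : X => y := by
  intro i
  exact FirstOrder.Language.definableFun_const L _ (mem_univ _)

@[fun_prop]
theorem DefMap.comp {g : Y → Z} {f : X → Y} (hg : DefMap L g) (hf : DefMap L f) :
    DefMap L fun x => g (f x) := by
  intro i
  simpa using DefinableFun.comp hf (hg i)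

@[fun_prop]
theorem DefMap.prodMk {f : X → Y} {g : X → Z} (hf : DefMap L f) (hg : DefMap L g) :
    DefMap L fun x => (f x, g x) := by
  rintro (i | i)
  · exact hf i
  · exact hg i

@[fun_prop]
theorem DefMap.fst : DefMap L (Prod.fst : X × Y → X) := by
  intro i
  have (v : Idx X ⊕ Idx Y → ℝ) : coords (coords.symm (v ∘ Sum.inl) : X) i = v (Sum.inl i) := by simp
  refine (congrArg _ (funext this)).mpr ?_
  exact DefinableFun.proj (A := (univ : Set ℝ)) L (i := (Sum.inl i : Idx X ⊕ Idx Y))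

@[fun_prop]
theorem DefMap.snd : DefMap L (Prod.snd : X × Y → Y) := by
  intro i
  have (v : Idx X ⊕ Idx Y → ℝ) : coords (coords.symm (v ∘ Sum.inr) : Y) i = v (Sum.inr i) := by simp
  refine (congrArg _ (funext this)).mpr ?_
  exact DefinableFun.proj (A := (univ : Set ℝ)) L (i := (Sum.inr i : Idx X ⊕ Idx Y))

@[fun_prop]
theorem DefMap.apply {n : ℕ} (i : Fin n) : DefMap L fun x : Fin n → ℝ => x i := by
  intro _
  exact DefinableFun.proj (A := (univ : Set ℝ)) L (i := (i : Fin n))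

@[fun_prop]
theorem DefMap.pi {n : ℕ} {f : X → Fin n → ℝ} (hf : ∀ i, DefMap L fun x => f x i) :
    DefMap L fun x i => f x i :=
  fun i => hf i ()

@[fun_prop]
theorem DefPred.mem {S : Set Y} (hS : DefSet L S) {f : X → Y} (hf : DefMap L f) :
    DefPred L fun x => f x ∈ S :=
  DefPred.comp hS hf

theorem def_iff_defSet {n : ℕ} {s : Set (Fin n → ℝ)} : Def L n s ↔ DefSet L s := Iff.rfl

@[fun_prop]
theorem DefPred.eq {f g : X → Y} (hf : DefMap L f) (hg : DefMap L g) :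
    DefPred L fun x => f x = g x := by
  have : DefPred L fun x => ∀ i, coords (f x) i = coords (g x) i :=
    DefPred.forall_finite fun i => (hf i).ofPred_eq (hg i)
  exact this.congr fun x => by rw [← funext_iff, coords.injective.eq_iff]

/-- A real-valued function is definable as soon as its graph is. -/
theorem DefMap.of_graph {f : X → ℝ} (h : DefPred L fun p : X × ℝ => f p.1 = p.2) :
    DefMap L f := by
  intro i
  have := h.preimage_comp
    (fun j : Idx X ⊕ Unit => (Sum.elim some (fun _ => none) j : Option (Idx X)))
  exact this


end Definability

section Field

variable {L : FirstOrder.Language.{u, v}} [L.Structure ℝ] [hF : Fact (ExpandsOrderedField L)]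
variable {X Y : Type} [RealTuple X] [RealTuple Y]

@[fun_prop]
theorem DefPred.lt {f g : X → ℝ} (hf : DefMap L f) (hg : DefMap L g) :
    DefPred L fun x => f x < g x := by
  refine DefPred.comp (def_iff_defSet.1 hF.out.1) (f := fun x => ![f x, g x])
    (DefMap.pi fun i => ?_)
  fin_cases i <;> simpa

@[fun_prop]
theorem DefPred.le {f g : X → ℝ} (hf : DefMap L f) (hg : DefMap L g) :
    DefPred L fun x => f x ≤ g x :=
  (DefPred.lt hg hf).not.congr fun _ => not_lt

@[fun_prop]
theorem DefMap.add {f g : X → ℝ} (hf : DefMap L f) (hg : DefMap L g) :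
    DefMap L fun x => f x + g x := by
  refine DefMap.of_graph (DefPred.comp (def_iff_defSet.1 hF.out.2.1)
    (f := fun p : X × ℝ => ![f p.1, g p.1, p.2]) (DefMap.pi fun i => ?_))
  fin_cases i <;> simp <;> fun_prop

@[fun_prop]
theorem DefMap.mul {f g : X → ℝ} (hf : DefMap L f) (hg : DefMap L g) :
    DefMap L fun x => f x * g x := by
  refine DefMap.of_graph (DefPred.comp (def_iff_defSet.1 hF.out.2.2.1)
    (f := fun p : X × ℝ => ![f p.1, g p.1, p.2]) (DefMap.pi fun i => ?_))
  fin_cases i <;> simp <;> fun_prop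

@[fun_prop]
theorem DefMap.neg {f : X → ℝ} (hf : DefMap L f) : DefMap L fun x => -f x := by
  have : DefMap L fun x => (-1) * f x := by fun_prop
  simpa using this

@[fun_prop]
theorem DefMap.sub {f g : X → ℝ} (hf : DefMap L f) (hg : DefMap L g) :
    DefMap L fun x => f x - g x := by
  simp only [sub_eq_add_neg]
  fun_prop

@[fun_prop]
theorem DefMap.inv {f : X → ℝ} (hf : DefMap L f) : DefMap L fun x => (f x)⁻¹ := by
  refine DefMap.of_graph ?_
  have : DefPred L fun p : X × ℝ => (f p.1 = 0 ∧ p.2 = 0) ∨ f p.1 * p.2 = 1 := by fun_prop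
  refine this.congr fun p => ⟨?_, ?_⟩
  · rintro (⟨h1, h2⟩ | h)
    · rw [h1, h2, inv_zero]
    · exact inv_eq_of_mul_eq_one_right h
  · rintro h
    by_cases h0 : f p.1 = 0
    · left; simp_all
    · right; rw [← h]; exact mul_inv_cancel₀ h0

@[fun_prop]
theorem DefMap.div {f g : X → ℝ} (hf : DefMap L f) (hg : DefMap L g) :
    DefMap L fun x => f x / g x := by
  simp only [div_eq_mul_inv]
  fun_prop

@[fun_prop]
theorem DefMap.pow {f : X → ℝ} (hf : DefMap L f) (n : ℕ) : DefMap L fun x => f x ^ n := by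
  induction n with
  | zero => simpa using DefMap.const 1
  | succ n ih => simp only [pow_succ]; fun_prop

@[fun_prop]
theorem DefMap.sum {ι : Type*} {s : Finset ι} {f : ι → X → ℝ} (hf : ∀ i, DefMap L (f i)) :
    DefMap L fun x => ∑ i ∈ s, f i x := by
  classical
  induction s using Finset.induction_on with
  | empty => simpa using DefMap.const 0
  | insert a s ha ih => simp only [Finset.sum_insert ha]; fun_prop

@[fun_prop]
theorem DefMap.prod {ι : Type*} {s : Finset ι} {f : ι → X → ℝ} (hf : ∀ i, DefMap L (f i)) :
    DefMap L fun x => ∏ i ∈ s, f i x := by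
  classical
  induction s using Finset.induction_on with
  | empty => simpa using DefMap.const 1
  | insert a s ha ih => simp only [Finset.prod_insert ha]; fun_prop

omit hF in
open Classical in
@[fun_prop]
theorem DefMap.ite {P : X → Prop} {f g : X → ℝ} (hP : DefPred L P) (hf : DefMap L f)
    (hg : DefMap L g) : DefMap L fun x => if P x then f x else g x := by
  refine DefMap.of_graph ?_
  have : DefPred L fun p : X × ℝ => (P p.1 ∧ f p.1 = p.2) ∨ (¬ P p.1 ∧ g p.1 = p.2) :=
    ((hP.comp DefMap.fst).and (by fun_prop)).or ((hP.comp DefMap.fst).not.and (by fun_prop))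
  refine this.congr fun p => ?_
  by_cases h : P p.1 <;> simp [h]

@[fun_prop]
theorem DefMap.abs {f : X → ℝ} (hf : DefMap L f) : DefMap L fun x => |f x| := by
  classical
  have : DefMap L fun x => if 0 ≤ f x then f x else -f x := by fun_prop
  convert this using 2 with x
  split_ifs with h
  · exact abs_of_nonneg h
  · exact abs_of_neg (not_le.1 h)

@[fun_prop]
theorem DefMap.norm {n : ℕ} {f : X → Fin n → ℝ} (hf : DefMap L f) :
    DefMap L fun x => ‖f x‖ := by
  refine DefMap.of_graph ?_
  have : DefPred L fun p : X × ℝ => 0 ≤ p.2 ∧ ∀ z : ℝ, 0 ≤ z → (p.2 ≤ z ↔ ∀ i, |f p.1 i| ≤ z) := by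
    fun_prop
  refine this.congr fun p => ⟨?_, ?_⟩
  · rintro ⟨h0, h⟩
    have key : ∀ z : ℝ, 0 ≤ z → (p.2 ≤ z ↔ ‖f p.1‖ ≤ z) := fun z hz => by
      rw [h z hz, pi_norm_le_iff_of_nonneg hz]; rfl
    exact le_antisymm ((key _ h0).1 le_rfl) ((key _ (norm_nonneg _)).2 le_rfl)
  · intro h
    rw [← h]
    exact ⟨norm_nonneg _, fun z hz => pi_norm_le_iff_of_nonneg hz⟩

@[fun_prop]
theorem DefMap.vecSub {n : ℕ} {f g : X → Fin n → ℝ} (hf : DefMap L f) (hg : DefMap L g) :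
    DefMap L fun x => f x - g x := by
  have : DefMap L fun x i => f x i - g x i := by fun_prop
  exact this

open Classical in
/-- The unique point with a given property, or a default value if there is no unique one. -/
noncomputable def uniqueChoice {Y : Type} (P : Y → Prop) (y₀ : Y) : Y :=
  if h : ∃! y, P y then h.choose else y₀

theorem uniqueChoice_spec {Y : Type} {P : Y → Prop} {y₀ : Y} (h : ∃! y, P y) :
    P (uniqueChoice P y₀) := by
  rw [uniqueChoice, dif_pos h]
  exact h.choose_spec.1

theorem uniqueChoice_eq {Y : Type} {P : Y → Prop} {y₀ y : Y} (h : P y)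
    (h' : ∀ z, P z → z = y) : uniqueChoice P y₀ = y :=
  h' _ (uniqueChoice_spec ⟨y, h, h'⟩)

omit hF in
theorem DefMap.uniqueChoice {n : ℕ} {P : X → (Fin n → ℝ) → Prop} {y₀ : Fin n → ℝ}
    (hP : DefSet L {p : X × (Fin n → ℝ) | P p.1 p.2}) :
    DefMap L fun x => uniqueChoice (P x) y₀ := by
  have hP2 {Z : Type} [RealTuple Z] {f : Z → X} {g : Z → Fin n → ℝ} (hf : DefMap L f)
      (hg : DefMap L g) : DefPred L fun z => P (f z) (g z) :=
    DefPred.comp hP (f := fun z => (f z, g z)) (by fun_prop)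
  have hu {Z : Type} [RealTuple Z] {f : Z → X} (hf : DefMap L f) :
      DefPred L fun z => ∃! y, P (f z) y := by
    refine DefPred.exists ((hP2 (by fun_prop) (by fun_prop)).and (DefPred.forall ?_))
    exact (hP2 (by fun_prop) (by fun_prop)).imp (by fun_prop)
  have key : ∀ x y, Paper.uniqueChoice (P x) y₀ = y ↔
      ((∃! z, P x z) ∧ P x y) ∨ (¬ (∃! z, P x z) ∧ y = y₀) := by
    intro x y
    by_cases h : ∃! z, P x z
    · simp only [h, true_and, not_true_eq_false, false_and, or_false]
      exact ⟨fun e => e ▸ uniqueChoice_spec h, fun hy => h.unique (uniqueChoice_spec h) hy⟩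
    · simp only [h, false_and, not_false_eq_true, true_and, false_or]
      rw [Paper.uniqueChoice, dif_neg h, eq_comm]
  refine DefMap.pi fun i => DefMap.of_graph ?_
  have : DefPred L fun p : X × ℝ => ∃ y : Fin n → ℝ, (((∃! z, P p.1 z) ∧ P p.1 y) ∨
      (¬ (∃! z, P p.1 z) ∧ y = y₀)) ∧ y i = p.2 := by
    refine DefPred.exists (DefPred.and (DefPred.or ?_ ?_) (by fun_prop))
    · exact (hu (by fun_prop)).and (hP2 (by fun_prop) (by fun_prop))
    · exact (hu (by fun_prop)).not.and (by fun_prop)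
  refine this.congr fun p => ?_
  simp only [← key, exists_eq_left']

theorem DefPred.eventually {n : ℕ} {P : X → (Fin n → ℝ) → Prop} {f : X → Fin n → ℝ}
    (hP : DefPred L fun p : X × (Fin n → ℝ) => P p.1 p.2) (hf : DefMap L f) :
    DefPred L fun x => ∀ᶠ y in 𝓝 (f x), P x y := by
  have : DefPred L fun x => ∃ δ : ℝ, 0 < δ ∧ ∀ y, ‖y - f x‖ < δ → P x y := by
    refine DefPred.exists (DefPred.and (by fun_prop)
      (DefPred.forall (DefPred.imp (by fun_prop) ?_)))
    exact hP.comp (f := fun p : (X × ℝ) × (Fin n → ℝ) => (p.1.1, p.2)) (by fun_prop)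
  refine this.congr fun x => ?_
  simp only [Metric.eventually_nhds_iff, dist_eq_norm]

theorem DefPred.eventually_real {P : X → ℝ → Prop} {f : X → ℝ}
    (hP : DefPred L fun p : X × ℝ => P p.1 p.2) (hf : DefMap L f) :
    DefPred L fun x => ∀ᶠ y in 𝓝 (f x), P x y := by
  have : DefPred L fun x => ∃ δ : ℝ, 0 < δ ∧ ∀ y, |y - f x| < δ → P x y := by
    refine DefPred.exists (DefPred.and (by fun_prop)
      (DefPred.forall (DefPred.imp (by fun_prop) ?_)))
    exact hP.comp (f := fun p : (X × ℝ) × ℝ => (p.1.1, p.2)) (by fun_prop)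
  refine this.congr fun x => ?_
  simp only [Metric.eventually_nhds_iff, dist_eq_norm]
  rfl

theorem DefSet.interior {n : ℕ} {S : Set (Fin n → ℝ)} (hS : DefSet L S) :
    DefSet L (interior S) :=
  (DefPred.eventually (f := fun x => x) (P := fun _ y => y ∈ S)
    (DefPred.mem hS (by fun_prop)) (by fun_prop)).congr fun x => by
      rw [mem_interior_iff_mem_nhds]; rfl

omit hF in
theorem DefSet.compl {S : Set X} (hS : DefSet L S) : DefSet L Sᶜ := DefPred.not hS

omit hF in
theorem DefSet.inter {S T : Set X} (hS : DefSet L S) (hT : DefSet L T) : DefSet L (S ∩ T) :=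
  DefPred.and hS hT

omit hF in
theorem DefSet.diff {S T : Set X} (hS : DefSet L S) (hT : DefSet L T) : DefSet L (S \ T) :=
  DefPred.and hS (DefPred.not hT)

theorem DefSet.closure {n : ℕ} {S : Set (Fin n → ℝ)} (hS : DefSet L S) :
    DefSet L (closure S) := by
  rw [closure_eq_compl_interior_compl]
  exact hS.compl.interior.compl

theorem DefSet.ball {n : ℕ} (a : Fin n → ℝ) (ε : ℝ) : DefSet L (Metric.ball a ε) := by
  have : DefPred L fun x => ‖x - a‖ < ε := by fun_prop
  exact this.congr fun x => by rw [mem_ball_iff_norm]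

/-- The greatest lower bounds of a definable family of nonempty sets of nonnegative reals
form a definable function. -/
theorem DefMap.csInf {P : X → ℝ → Prop} (hP : DefPred L fun p : X × ℝ => P p.1 p.2)
    (hbdd : ∀ x, BddBelow {s | P x s}) : DefMap L fun x => sInf {s | P x s} := by
  refine DefMap.of_graph ?_
  have hP2 {Z : Type} [RealTuple Z] {f : Z → X} {g : Z → ℝ} (hf : DefMap L f)
      (hg : DefMap L g) : DefPred L fun z => P (f z) (g z) :=
    DefPred.comp hP (f := fun z => (f z, g z)) (by fun_prop)
  have : DefPred L fun p : X × ℝ => ((∃ s, P p.1 s) ∧ ∀ b : ℝ, b ≤ p.2 ↔ ∀ s, P p.1 s → b ≤ s) ∨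
      (¬ (∃ s, P p.1 s) ∧ p.2 = 0) := by
    refine DefPred.or (DefPred.and ?_ (DefPred.forall ?_)) (DefPred.and (DefPred.not ?_) ?_)
    · exact DefPred.exists (hP2 (by fun_prop) (by fun_prop))
    · refine DefPred.iff (by fun_prop) (DefPred.forall (DefPred.imp ?_ (by fun_prop)))
      exact hP2 (by fun_prop) (by fun_prop)
    · exact DefPred.exists (hP2 (by fun_prop) (by fun_prop))
    · fun_prop
  refine this.congr fun p => ?_
  by_cases h : ∃ s, P p.1 s
  · have key : ∀ b, b ≤ sInf {s | P p.1 s} ↔ ∀ s, P p.1 s → b ≤ s := fun b =>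
      le_csInf_iff (hbdd p.1) h
    simp only [h, true_and, not_true_eq_false, false_and, or_false, ← key]
    exact ⟨fun e => le_antisymm ((e _).2 le_rfl) ((e _).1 le_rfl), fun e b => by rw [e]⟩
  · have : {s | P p.1 s} = ∅ := by ext s; simpa using fun hs => h ⟨s, hs⟩
    simp only [h, false_and, not_false_eq_true, true_and, false_or, this, Real.sInf_empty]
    exact eq_comm

end Field

section Tame

variable {L : FirstOrder.Language.{u, v}} [L.Structure ℝ]

theorem exists_Ioo_forall_or_forall_not (hO : LocallyOMinimal L) {P : ℝ → Prop}
    (hP : DefPred L P) (a : ℝ) : ∃ δ > 0,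
      ((∀ x ∈ Ioo a (a + δ), P x) ∨ ∀ x ∈ Ioo a (a + δ), ¬ P x) ∧
      ((∀ x ∈ Ioo (a - δ) a, P x) ∨ ∀ x ∈ Ioo (a - δ) a, ¬ P x) := by
  have hD : Def1 L {x | P x} :=
    def_iff_defSet.2 (DefPred.comp hP (f := fun x : Fin 1 → ℝ => x 0) (by fun_prop))
  obtain ⟨b, c, hba, hac, F, J, hFJ⟩ := hO _ hD a
  set E : Set ℝ := ↑F ∪ (Prod.fst '' (J : Set (ℝ × ℝ)) ∪ Prod.snd '' (J : Set (ℝ × ℝ))) with hE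
  have hEfin : E.Finite :=
    F.finite_toSet.union ((J.finite_toSet.image _).union (J.finite_toSet.image _))
  have key : ∀ u v, Ioo u v ⊆ Ioo b c → (∀ x ∈ Ioo u v, x ∉ E) →
      (∀ x ∈ Ioo u v, P x) ∨ ∀ x ∈ Ioo u v, ¬ P x := by
    intro u v huv hav
    by_contra! hcon
    obtain ⟨⟨y, hy, hPy⟩, x, hx, hPx⟩ := hcon
    have hxm : x ∈ {x | P x} ∩ Ioo b c := ⟨hPx, huv hx⟩
    rw [hFJ] at hxm
    rcases hxm with h | h
    · exact hav x hx (Or.inl h)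
    · simp only [mem_iUnion, exists_prop] at h
      obtain ⟨p, hp, hxp⟩ := h
      have h1 : p.1 ∈ E := Or.inr (Or.inl ⟨p, hp, rfl⟩)
      have h2 : p.2 ∈ E := Or.inr (Or.inr ⟨p, hp, rfl⟩)
      have hyp : y ∈ Ioo p.1 p.2 := by
        constructor
        · by_contra! hlt
          exact hav p.1 ⟨hy.1.trans_le hlt, hxp.1.trans hx.2⟩ h1
        · by_contra! hlt
          exact hav p.2 ⟨hx.1.trans hxp.2, hlt.trans_lt hy.2⟩ h2
      have : y ∈ {x | P x} ∩ Ioo b c := by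
        rw [hFJ]
        exact Or.inr (mem_iUnion₂.2 ⟨p, hp, hyp⟩)
      exact hPy this.1
  have hnhds : (E \ {a})ᶜ ∩ Ioo b c ∈ 𝓝 a := by
    refine Filter.inter_mem ?_ (Ioo_mem_nhds hba hac)
    exact (hEfin.subset sdiff_subset).isClosed.isOpen_compl.mem_nhds (by simp)
  obtain ⟨δ, hδ, hball⟩ := Metric.mem_nhds_iff.1 hnhds
  rw [Real.ball_eq_Ioo] at hball
  refine ⟨δ, hδ, key _ _ ?_ ?_, key _ _ ?_ ?_⟩
  · exact fun x hx => (hball ⟨by linarith [hx.1], hx.2⟩).2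
  · exact fun x hx hxE => (hball ⟨by linarith [hx.1], hx.2⟩).1 ⟨hxE, hx.1.ne'⟩
  · exact fun x hx => (hball ⟨hx.1, by linarith [hx.2]⟩).2
  · exact fun x hx hxE => (hball ⟨hx.1, by linarith [hx.2]⟩).1 ⟨hxE, hx.2.ne⟩

variable [hF : Fact (ExpandsOrderedField L)] [hO : Fact (LocallyOMinimal L)]

omit hF in
theorem DefPred.eventually_or_eventually_not {P : ℝ → Prop} (hP : DefPred L P) (a : ℝ) :
    (∀ᶠ x in 𝓝[>] a, P x) ∨ ∀ᶠ x in 𝓝[>] a, ¬ P x := by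
  obtain ⟨δ, hδ, h, -⟩ := exists_Ioo_forall_or_forall_not hO.out hP a
  have := Ioo_mem_nhdsGT (show a < a + δ by linarith)
  exact h.imp (fun h => Filter.mem_of_superset this h) (fun h => Filter.mem_of_superset this h)

omit hF in
theorem DefPred.exists_Ioo {P : ℝ → Prop} (hP : DefPred L P) {a b : ℝ} (hab : a < b) :
    ∃ c d, a < c ∧ c < d ∧ d < b ∧ ((∀ x ∈ Ioo c d, P x) ∨ ∀ x ∈ Ioo c d, ¬ P x) := by
  obtain ⟨δ, hδ, h, -⟩ := exists_Ioo_forall_or_forall_not hO.out hP ((a + b) / 2)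
  refine ⟨(a + b) / 2, min ((a + b) / 2 + δ) ((a + b) / 2 + (b - a) / 4), by linarith,
    lt_min (by linarith) (by linarith), (min_le_right _ _).trans_lt (by linarith), ?_⟩
  exact h.imp (fun h x hx => h x ⟨hx.1, hx.2.trans_le (min_le_left _ _)⟩)
    (fun h x hx => h x ⟨hx.1, hx.2.trans_le (min_le_left _ _)⟩)

omit hF in
theorem cons_mem_ball {m : ℕ} {c : Fin (m + 1) → ℝ} {ε t : ℝ} {x : Fin m → ℝ} (hε : 0 < ε) :
    (Fin.cons t x : Fin (m + 1) → ℝ) ∈ Metric.ball c ε ↔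
      |t - c 0| < ε ∧ x ∈ Metric.ball (Fin.tail c) ε := by
  rw [Metric.mem_ball, Metric.mem_ball, dist_pi_lt_iff hε, dist_pi_lt_iff hε, Fin.forall_fin_succ]
  rfl

omit hF hO in
@[fun_prop]
theorem DefMap.cons {m : ℕ} {X : Type} [RealTuple X] {t : X → ℝ} {x : X → Fin m → ℝ}
    (ht : DefMap L t) (hx : DefMap L x) :
    DefMap L fun p => (Fin.cons (t p) (x p) : Fin (m + 1) → ℝ) := by
  refine DefMap.pi fun i => ?_
  refine Fin.cases ?_ (fun i => ?_) i
  · simpa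
  · simp only [Fin.cons_succ]
    fun_prop

theorem isNowhereDense_of_defSet {m : ℕ} {S : Set (Fin m → ℝ)} (hS : DefSet L S)
    (hSi : interior S = ∅) : IsNowhereDense S := by
  induction m with
  | zero =>
    have : IsOpen S := isOpen_discrete S
    rw [this.interior_eq] at hSi
    simp [hSi]
  | succ m ih =>
    by_contra hne
    obtain ⟨c, hc⟩ := nonempty_iff_ne_empty.2 hne
    obtain ⟨ε, hε, hball⟩ := Metric.mem_nhds_iff.1 (mem_interior_iff_mem_nhds.1 hc)
    have hSP {Z : Type} [RealTuple Z] {f : Z → Fin (m + 1) → ℝ} (hf : DefMap L f) :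
        DefPred L fun z => f z ∈ S := DefPred.comp hS hf
    have hcons : Continuous fun p : ℝ × (Fin m → ℝ) => (Fin.cons p.1 p.2 : Fin (m + 1) → ℝ) := by
      fun_prop
    have htail : Continuous (Fin.tail : (Fin (m + 1) → ℝ) → Fin m → ℝ) := by
      unfold Fin.tail; fun_prop
    have hsub : Metric.ball (Fin.tail c) ε ⊆
        (⋃ q : {q : ℚ × ℚ // q.1 < q.2},
          {x | ∀ t : ℝ, q.1.1 < t ∧ t < q.1.2 → (Fin.cons t x : Fin (m + 1) → ℝ) ∈ S}) ∪
        ⋃ q : {q : ℚ × ℚ // q.1 < q.2 ∧ c 0 - ε < q.1 ∧ q.2 < c 0 + ε},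
          {x | x ∈ Metric.ball (Fin.tail c) ε ∧
            ∀ t : ℝ, q.1.1 < t ∧ t < q.1.2 → (Fin.cons t x : Fin (m + 1) → ℝ) ∉ S} := by
      intro x hx
      obtain ⟨u, v, hu, huv, hv, h⟩ := DefPred.exists_Ioo
        (P := fun t => (Fin.cons t x : Fin (m + 1) → ℝ) ∈ S) (hSP (by fun_prop))
        (show c 0 - ε < c 0 + ε by linarith)
      obtain ⟨q1, hq1, hq1'⟩ := exists_rat_btwn huv
      obtain ⟨q2, hq2, hq2'⟩ := exists_rat_btwn hq1'
      rcases h with h | h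
      · refine Or.inl (mem_iUnion.2 ⟨⟨(q1, q2), by exact_mod_cast hq2⟩, ?_⟩)
        exact fun t ht => h t ⟨hq1.trans ht.1, ht.2.trans hq2'⟩
      · refine Or.inr (mem_iUnion.2 ⟨⟨(q1, q2), by exact_mod_cast hq2, hu.trans hq1,
          hq2'.trans hv⟩, hx, ?_⟩)
        exact fun t ht => h t ⟨hq1.trans ht.1, ht.2.trans hq2'⟩
    refine not_isMeagre_of_isOpen Metric.isOpen_ball (Metric.nonempty_ball.2 hε)
      (IsMeagre.mono hsub ?_)
    refine IsMeagre.union (isMeagre_iUnion fun q => IsNowhereDense.isMeagre (ih ?_ ?_))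
      (isMeagre_iUnion fun q => IsNowhereDense.isMeagre (ih ?_ ?_))
    · exact DefPred.forall ((by fun_prop : DefPred L _).imp (hSP (by fun_prop)))
    · by_contra hi
      obtain ⟨x, hx⟩ := nonempty_iff_ne_empty.2 hi
      obtain ⟨t, ht1, ht2⟩ := exists_between (show (q.1.1 : ℝ) < q.1.2 by exact_mod_cast q.2)
      have hO : IsOpen {z : Fin (m + 1) → ℝ | (q.1.1 < z 0 ∧ z 0 < q.1.2) ∧
          Fin.tail z ∈ interior {x | ∀ t : ℝ, q.1.1 < t ∧ t < q.1.2 →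
            (Fin.cons t x : Fin (m + 1) → ℝ) ∈ S}} :=
        ((isOpen_lt continuous_const (continuous_apply 0)).inter
          (isOpen_lt (continuous_apply 0) continuous_const)).inter (isOpen_interior.preimage htail)
      have : (Fin.cons t x : Fin (m + 1) → ℝ) ∈ interior S := by
        refine mem_interior.2 ⟨_, fun z hz => ?_, hO, ?_⟩
        · have := interior_subset hz.2 (z 0) hz.1
          rwa [Fin.cons_self_tail] at this
        · exact ⟨⟨by simpa using ht1, by simpa using ht2⟩, by simpa using hx⟩
      simp [hSi] at this
    · exact (DefSet.ball _ _).and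
        (DefPred.forall ((by fun_prop : DefPred L _).imp (hSP (by fun_prop)).not))
    · by_contra hi
      obtain ⟨x, hx⟩ := nonempty_iff_ne_empty.2 hi
      obtain ⟨hq, hq1, hq2⟩ := q.2
      obtain ⟨t, ht1, ht2⟩ := exists_between (show (q.1.1 : ℝ) < q.1.2 by exact_mod_cast hq)
      have hO : IsOpen {z : Fin (m + 1) → ℝ | (q.1.1 < z 0 ∧ z 0 < q.1.2) ∧
          Fin.tail z ∈ interior {x | x ∈ Metric.ball (Fin.tail c) ε ∧
            ∀ t : ℝ, q.1.1 < t ∧ t < q.1.2 → (Fin.cons t x : Fin (m + 1) → ℝ) ∉ S}} :=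
        ((isOpen_lt continuous_const (continuous_apply 0)).inter
          (isOpen_lt (continuous_apply 0) continuous_const)).inter (isOpen_interior.preimage htail)
      have hmem : (Fin.cons t x : Fin (m + 1) → ℝ) ∈ closure S := by
        refine hball ((cons_mem_ball hε).2 ⟨?_, (interior_subset hx).1⟩)
        rw [abs_lt]
        constructor <;> linarith
      obtain ⟨z, hz, hzS⟩ := mem_closure_iff.1 hmem _ hO
        ⟨⟨by simpa using ht1, by simpa using ht2⟩, by simpa using hx⟩
      have := (interior_subset hz.2).2 (z 0) hz.1
      rw [Fin.cons_self_tail] at this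
      exact this hzS

theorem exists_isOpen_subset_of_subset_iUnion {m : ℕ} {ι : Type*} [Countable ι]
    {S : ι → Set (Fin m → ℝ)} (hS : ∀ i, DefSet L (S i)) {U M : Set (Fin m → ℝ)} (hU : IsOpen U)
    (hUne : U.Nonempty) (hM : IsMeagre M) (hsub : U ⊆ M ∪ ⋃ i, S i) :
    ∃ i, ∃ V ⊆ U, IsOpen V ∧ V.Nonempty ∧ V ⊆ S i := by
  by_contra! hcon
  obtain ⟨c, hc⟩ := hUne
  obtain ⟨ε, hε, hball⟩ := Metric.isOpen_iff.1 hU c hc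
  refine not_isMeagre_of_isOpen Metric.isOpen_ball (Metric.nonempty_ball.2 hε)
    (IsMeagre.mono (s := M ∪ ⋃ i, S i ∩ Metric.ball c ε) (t := Metric.ball c ε)
      (fun x hx => ?_) (hM.union (isMeagre_iUnion fun i =>
      (isNowhereDense_of_defSet ((hS i).inter (DefSet.ball c ε)) ?_).isMeagre)))
  swap
  · by_contra hi
    refine hcon i _ ?_ isOpen_interior (nonempty_iff_ne_empty.2 hi)
      (interior_subset.trans inter_subset_left)
    exact interior_subset.trans (inter_subset_right.trans hball)
  · refine (hsub (hball hx)).imp id fun h => ?_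
    obtain ⟨i, hi⟩ := mem_iUnion.1 h
    exact mem_iUnion.2 ⟨i, hi, hx⟩

theorem DefPred.exists_isOpen_subset {m : ℕ} {P : (Fin m → ℝ) → Prop} (hP : DefPred L P)
    {U : Set (Fin m → ℝ)} (hU : IsOpen U) (hUne : U.Nonempty)
    (h : ∀ V ⊆ U, IsOpen V → V.Nonempty → ∃ x ∈ V, P x) :
    ∃ V ⊆ U, IsOpen V ∧ V.Nonempty ∧ ∀ x ∈ V, P x := by
  obtain ⟨b, V, hVU, hV, hVne, hVS⟩ := exists_isOpen_subset_of_subset_iUnion (L := L)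
    (S := fun b : Bool => {x | if b then P x else ¬ P x})
    (by rintro (_ | _); exacts [hP.not.congr fun x => by simp, hP.congr fun x => by simp])
    hU hUne IsMeagre.empty (fun x _ => by
      by_cases hx : P x
      · exact Or.inr (mem_iUnion.2 ⟨true, by simpa⟩)
      · exact Or.inr (mem_iUnion.2 ⟨false, by simpa⟩))
  obtain ⟨x, hx, hPx⟩ := h V hVU hV hVne
  cases b
  · have := hVS hx
    simp [hPx] at this
  · exact ⟨V, hVU, hV, hVne, fun y hy => by simpa using hVS hy⟩

omit hO in
theorem DefPred.continuousAt {m : ℕ} {X : Type} [RealTuple X] {f : X → (Fin m → ℝ) → ℝ}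
    (hf : DefMap L fun p : X × (Fin m → ℝ) => f p.1 p.2) {g : X → Fin m → ℝ} (hg : DefMap L g) :
    DefPred L fun x => ContinuousAt (f x) (g x) := by
  have hf' {Z : Type} [RealTuple Z] {a : Z → X} {b : Z → Fin m → ℝ} (ha : DefMap L a)
      (hb : DefMap L b) : DefMap L fun z => f (a z) (b z) :=
    DefMap.comp hf (f := fun z => (a z, b z)) (by fun_prop)
  have : DefPred L fun x => ∀ ε : ℝ, 0 < ε → ∀ᶠ y in 𝓝 (g x), |f x y - f x (g x)| < ε := by
    refine DefPred.forall (DefPred.imp (by fun_prop) (DefPred.eventually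
      (P := fun (p : X × ℝ) y => |f p.1 y - f p.1 (g p.1)| < p.2) ?_ (by fun_prop)))
    refine DefPred.lt (DefMap.abs (DefMap.sub (hf' ?_ ?_) (hf' ?_ ?_))) ?_ <;> fun_prop
  refine this.congr fun x => ?_
  rw [ContinuousAt, Metric.tendsto_nhds]
  rfl

theorem DefMap.exists_isOpen_continuousAt {m : ℕ} {f : (Fin m → ℝ) → ℝ} (hf : DefMap L f)
    {U : Set (Fin m → ℝ)} (hU : IsOpen U) (hUne : U.Nonempty) :
    ∃ V ⊆ U, IsOpen V ∧ V.Nonempty ∧ ∀ x ∈ V, ContinuousAt f x := by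
  refine DefPred.exists_isOpen_subset (L := L)
    (DefPred.continuousAt (f := fun _ : Fin m → ℝ => f) (by fun_prop) (by fun_prop)) hU hUne ?_
  intro V _ hV hVne
  by_contra! hcon
  have hmeagre (S : Set (Fin m → ℝ)) (hS : DefSet L S) : IsMeagre (S \ interior S) := by
    refine (isNowhereDense_of_defSet (hS.diff hS.interior) ?_).isMeagre
    rw [sdiff_eq, interior_inter, interior_compl]
    refine eq_empty_of_forall_notMem fun x hx => hx.2 (subset_closure hx.1)
  refine not_isMeagre_of_isOpen hV hVne (IsMeagre.mono (fun x hx => ?_) (IsMeagre.union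
    (isMeagre_iUnion fun q : ℚ => hmeagre {x | q < f x} 
      (show DefPred L _ by simp only [mem_ofPred_eq]; fun_prop))
    (isMeagre_iUnion fun q : ℚ => hmeagre {x | f x < q} 
      (show DefPred L _ by simp only [mem_ofPred_eq]; fun_prop))))
  by_contra hx'
  simp only [mem_union, mem_iUnion, mem_sdiff, mem_ofPred_eq, not_or, not_exists, not_and,
    not_not] at hx'
  refine hcon x hx (tendsto_order.2 ⟨fun a ha => ?_, fun a ha => ?_⟩)
  · obtain ⟨q, hq1, hq2⟩ := exists_rat_btwn ha
    filter_upwards [mem_interior_iff_mem_nhds.1 (hx'.1 q hq2)] with y hy using hq1.trans hy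
  · obtain ⟨q, hq1, hq2⟩ := exists_rat_btwn ha
    filter_upwards [mem_interior_iff_mem_nhds.1 (hx'.2 q hq1)] with y hy using lt_trans hy hq2

end Tame

section Calculus

/-- The partial derivative of `f` in the `i`-th direction. -/
noncomputable def pderiv {n : ℕ} (i : Fin n) (f : (Fin n → ℝ) → ℝ) (x : Fin n → ℝ) : ℝ :=
  lineDeriv ℝ f x (Pi.single i 1)

/-- The function `f` has a partial derivative in the `i`-th direction at `x`. -/
def HasPderiv {n : ℕ} (i : Fin n) (f : (Fin n → ℝ) → ℝ) (x : Fin n → ℝ) : Prop :=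
  LineDifferentiableAt ℝ f x (Pi.single i 1)

theorem abs_sub_sub_mul_le {n : ℕ} {f : (Fin n → ℝ) → ℝ} {i : Fin n} {w : Fin n → ℝ}
    {s c ε : ℝ} (h : ∀ t ∈ uIcc 0 s, HasPderiv i f (w + t • Pi.single i 1) ∧
      |pderiv i f (w + t • Pi.single i 1) - c| ≤ ε) :
    |f (w + s • Pi.single i 1) - f w - s * c| ≤ ε * |s| := by
  have hd : ∀ t ∈ uIcc 0 s, HasDerivWithinAt (fun t => f (w + t • Pi.single i 1) - t * c)
      (pderiv i f (w + t • Pi.single i 1) - c) (uIcc 0 s) t := by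
    intro t ht
    have h1 := (h t ht).1.hasLineDerivAt
    rw [HasLineDerivAt, ← sub_self t] at h1
    have h2 := (h1.comp_sub_const t t).sub ((hasDerivAt_id t).mul_const c)
    simp only [one_mul] at h2
    refine (h2.congr_of_eventuallyEq (Filter.Eventually.of_forall fun y => ?_)).hasDerivWithinAt
    simp only [id, Pi.sub_apply, add_assoc, ← add_smul, add_sub_cancel]
  have := Convex.norm_image_sub_le_of_norm_hasDerivWithin_le hd (fun t ht => (h t ht).2)
    (convex_uIcc 0 s) left_mem_uIcc right_mem_uIcc
  simp only [Real.norm_eq_abs, zero_smul, add_zero, zero_mul, sub_zero] at this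
  rwa [sub_right_comm] at this

theorem hasFDerivAt_of_continuousAt_pderiv {n : ℕ} {f : (Fin n → ℝ) → ℝ} {x : Fin n → ℝ}
    (hd : ∀ᶠ y in 𝓝 x, ∀ i, HasPderiv i f y) (hc : ∀ i, ContinuousAt (pderiv i f) x) :
    HasFDerivAt f (∑ i, pderiv i f x • (ContinuousLinearMap.proj i : (Fin n → ℝ) →L[ℝ] ℝ)) x := by
  have key : ∀ S : Finset (Fin n), ∀ ε > 0, ∀ᶠ y in 𝓝 x,
      |f (S.piecewise y x) - f x - ∑ i ∈ S, (y i - x i) * pderiv i f x| ≤ ε * ‖y - x‖ := by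
    intro S
    induction S using Finset.induction_on with
    | empty =>
      intro ε hε
      refine Filter.Eventually.of_forall fun y => ?_
      simpa using mul_nonneg hε.le (norm_nonneg (y - x))
    | insert k S hk ih =>
      intro ε hε
      have h1 := hd.and ((hc k).eventually (Metric.closedBall_mem_nhds _ (half_pos hε)))
      obtain ⟨δ, hδ, hball⟩ := Metric.eventually_nhds_iff_ball.1 h1
      filter_upwards [ih _ (half_pos hε), Metric.ball_mem_nhds x hδ] with y hy hyδ
      have hup : (insert k S).piecewise y x =
          S.piecewise y x + (y k - x k) • Pi.single k 1 := by
        ext j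
        rw [Finset.piecewise_insert]
        by_cases hj : j = k
        · subst hj; simp [hk]
        · simp [hj]
      rw [Finset.sum_insert hk, hup]
      have h2 := abs_sub_sub_mul_le (f := f) (i := k) (w := S.piecewise y x) (s := y k - x k)
        (c := pderiv k f x) (ε := ε / 2) fun t ht => by
          have hmem : S.piecewise y x + t • Pi.single k 1 ∈ Metric.ball x δ := by
            rw [Metric.mem_ball, dist_pi_lt_iff hδ] at hyδ ⊢
            intro j
            by_cases hj : j = k
            · subst hj
              have h3 : |t| ≤ |y j - x j| := by
                have := abs_sub_left_of_mem_uIcc ht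
                simpa using this
              have h4 := hyδ j
              rw [Real.dist_eq] at h4 ⊢
              simpa [hk] using h3.trans_lt h4
            · by_cases hjS : j ∈ S
              · simpa [hj, hjS] using hyδ j
              · simpa [hj, hjS] using hδ
          exact ⟨(hball _ hmem).1 k, by simpa [Real.dist_eq] using (hball _ hmem).2⟩
      have h5 : |y k - x k| ≤ ‖y - x‖ := norm_le_pi_norm (y - x) k
      calc _ = |(f (S.piecewise y x + (y k - x k) • Pi.single k 1) - f (S.piecewise y x)
              - (y k - x k) * pderiv k f x) +
            (f (S.piecewise y x) - f x - ∑ i ∈ S, (y i - x i) * pderiv i f x)| := by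
              congr 1; ring
        _ ≤ ε / 2 * |y k - x k| + ε / 2 * ‖y - x‖ := (abs_add_le _ _).trans (add_le_add h2 hy)
        _ ≤ ε / 2 * ‖y - x‖ + ε / 2 * ‖y - x‖ := by gcongr
        _ = ε * ‖y - x‖ := by ring
  rw [hasFDerivAt_iff_isLittleO, Asymptotics.isLittleO_iff]
  intro ε hε
  filter_upwards [key Finset.univ ε hε] with y hy
  simpa [mul_comm] using hy

theorem contDiffAt_succ_iff_pderiv {n r : ℕ} {f : (Fin n → ℝ) → ℝ} {x : Fin n → ℝ} :
    ContDiffAt ℝ (r + 1) f x ↔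
      (∀ᶠ y in 𝓝 x, ∀ i, HasPderiv i f y) ∧ ∀ i, ContDiffAt ℝ r (pderiv i f) x := by
  rw [contDiffAt_succ_iff_hasFDerivAt]
  constructor
  · rintro ⟨f', ⟨u, hu, hf'⟩, hr⟩
    refine ⟨Filter.mem_of_superset hu fun y hy i =>
      (hf' y hy).differentiableAt.lineDifferentiableAt, fun i => ?_⟩
    have : ContDiffAt ℝ r (fun y => f' y (Pi.single i 1)) x := hr.clm_apply contDiffAt_const
    refine this.congr_of_eventuallyEq ?_
    filter_upwards [hu] with y hy
    exact ((hf' y hy).hasLineDerivAt _).lineDeriv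
  · rintro ⟨hd, hr⟩
    refine ⟨fun y => ∑ i, pderiv i f y • (ContinuousLinearMap.proj i : (Fin n → ℝ) →L[ℝ] ℝ),
      ?_, ?_⟩
    · refine ⟨_, hd.eventually_nhds.and (Filter.eventually_all.2 fun i =>
        (hr i).eventually (by simp)), fun y hy => ?_⟩
      exact hasFDerivAt_of_continuousAt_pderiv hy.1 fun i => (hy.2 i).continuousAt
    · exact ContDiffAt.sum fun i _ => (hr i).smul contDiffAt_const

theorem contDiffAt_zero_iff_eventually {n : ℕ} {f : (Fin n → ℝ) → ℝ} {x : Fin n → ℝ} :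
    ContDiffAt ℝ 0 f x ↔ ∀ᶠ y in 𝓝 x, ContinuousAt f y := by
  constructor
  · intro h
    exact (h.eventually (by simp)).mono fun y hy => hy.continuousAt
  · intro h
    exact contDiffAt_zero.2 ⟨_, h, fun y hy => ContinuousAt.continuousWithinAt hy⟩

end Calculus

section DefinableCalculus

variable {L : FirstOrder.Language.{u, v}} [L.Structure ℝ] [hF : Fact (ExpandsOrderedField L)]
variable {X : Type} [RealTuple X] {n : ℕ}

theorem DefPred.hasDerivAt {f : X → ℝ → ℝ} (hf : DefMap L fun p : X × ℝ => f p.1 p.2)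
    {d g : X → ℝ} (hd : DefMap L d) (hg : DefMap L g) :
    DefPred L fun x => HasDerivAt (f x) (d x) (g x) := by
  have hf' {Z : Type} [RealTuple Z] {a : Z → X} {b : Z → ℝ} (ha : DefMap L a)
      (hb : DefMap L b) : DefMap L fun z => f (a z) (b z) :=
    DefMap.comp hf (f := fun z => (a z, b z)) (by fun_prop)
  have : DefPred L fun x => ∀ c : ℝ, 0 < c → ∀ᶠ y in 𝓝 (g x),
      |f x y - f x (g x) - (y - g x) * d x| ≤ c * |y - g x| := by
    refine DefPred.forall (DefPred.imp (by fun_prop) (DefPred.eventually_real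
      (P := fun (p : X × ℝ) y => |f p.1 y - f p.1 (g p.1) - (y - g p.1) * d p.1| ≤
        p.2 * |y - g p.1|) (DefPred.le (DefMap.abs (DefMap.sub (DefMap.sub (hf' ?_ ?_)
          (hf' ?_ ?_)) ?_)) ?_) ?_)) <;> fun_prop
  refine this.congr fun x => ?_
  rw [hasDerivAt_iff_isLittleO, Asymptotics.isLittleO_iff]
  rfl

theorem DefPred.differentiableAt {f : X → ℝ → ℝ} (hf : DefMap L fun p : X × ℝ => f p.1 p.2)
    {g : X → ℝ} (hg : DefMap L g) : DefPred L fun x => DifferentiableAt ℝ (f x) (g x) := by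
  refine (DefPred.exists (P := fun x d => HasDerivAt (f x) d (g x))
    (DefPred.hasDerivAt (f := fun (p : X × ℝ) => f p.1)
    (d := fun p => p.2) (g := fun p => g p.1) ?_ ?_ ?_)).congr fun x =>
      ⟨fun ⟨d, hd⟩ => HasDerivAt.differentiableAt hd, fun h => ⟨_, h.hasDerivAt⟩⟩
  · exact DefMap.comp hf (f := fun z : (X × ℝ) × ℝ => (z.1.1, z.2)) (by fun_prop)
  all_goals fun_prop

theorem DefMap.deriv {f : X → ℝ → ℝ} (hf : DefMap L fun p : X × ℝ => f p.1 p.2)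
    {g : X → ℝ} (hg : DefMap L g) : DefMap L fun x => deriv (f x) (g x) := by
  refine DefMap.of_graph ?_
  have hf2 : DefMap L fun z : (X × ℝ) × ℝ => f z.1.1 z.2 :=
    DefMap.comp hf (f := fun z : (X × ℝ) × ℝ => (z.1.1, z.2)) (by fun_prop)
  have : DefPred L fun p : X × ℝ => HasDerivAt (f p.1) p.2 (g p.1) ∨
      (¬ DifferentiableAt ℝ (f p.1) (g p.1) ∧ p.2 = 0) :=
    (DefPred.hasDerivAt (f := fun (p : X × ℝ) => f p.1) hf2 (by fun_prop) (by fun_prop)).or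
      ((DefPred.differentiableAt (f := fun (p : X × ℝ) => f p.1) hf2 (by fun_prop)).not.and
        (by fun_prop))
  refine this.congr fun p => ⟨?_, fun h => ?_⟩
  · rintro (h | ⟨h, h0⟩)
    · exact h.deriv
    · rw [deriv_zero_of_not_differentiableAt h, h0]
  · by_cases hd : DifferentiableAt ℝ (f p.1) (g p.1)
    · exact Or.inl (h ▸ hd.hasDerivAt)
    · exact Or.inr ⟨hd, by rw [← h, deriv_zero_of_not_differentiableAt hd]⟩

@[fun_prop]
theorem DefMap.vecAdd {f g : X → Fin n → ℝ} (hf : DefMap L f) (hg : DefMap L g) :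
    DefMap L fun x => f x + g x := by
  have : DefMap L fun x i => f x i + g x i := by fun_prop
  exact this

@[fun_prop]
theorem DefMap.vecSMul {f : X → ℝ} {g : X → Fin n → ℝ} (hf : DefMap L f) (hg : DefMap L g) :
    DefMap L fun x => f x • g x := by
  have : DefMap L fun x i => f x * g x i := by fun_prop
  exact this

theorem DefPred.hasPderiv {f : X → (Fin n → ℝ) → ℝ}
    (hf : DefMap L fun p : X × (Fin n → ℝ) => f p.1 p.2) (i : Fin n) :
    DefPred L fun p : X × (Fin n → ℝ) => HasPderiv i (f p.1) p.2 :=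
  DefPred.differentiableAt (g := fun _ => 0)
    (f := fun (p : X × (Fin n → ℝ)) t => f p.1 (p.2 + t • Pi.single i 1))
    (DefMap.comp hf (f := fun z : (X × (Fin n → ℝ)) × ℝ => (z.1.1, z.1.2 + z.2 • Pi.single i 1))
      (by fun_prop)) (by fun_prop)

theorem DefMap.pderiv {f : X → (Fin n → ℝ) → ℝ}
    (hf : DefMap L fun p : X × (Fin n → ℝ) => f p.1 p.2) (i : Fin n) :
    DefMap L fun p : X × (Fin n → ℝ) => pderiv i (f p.1) p.2 :=
  DefMap.deriv (g := fun _ => 0)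
    (f := fun (p : X × (Fin n → ℝ)) t => f p.1 (p.2 + t • Pi.single i 1))
    (DefMap.comp hf (f := fun z : (X × (Fin n → ℝ)) × ℝ => (z.1.1, z.1.2 + z.2 • Pi.single i 1))
      (by fun_prop)) (by fun_prop)

theorem DefPred.contDiffAt {f : X → (Fin n → ℝ) → ℝ}
    (hf : DefMap L fun p : X × (Fin n → ℝ) => f p.1 p.2) (r : ℕ) :
    DefPred L fun p : X × (Fin n → ℝ) => ContDiffAt ℝ r (f p.1) p.2 := by
  induction r generalizing f with
  | zero =>
    refine DefPred.congr (fun p => contDiffAt_zero_iff_eventually.symm) (DefPred.eventually ?_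
      (by fun_prop))
    refine DefPred.continuousAt
      (f := fun (z : (X × (Fin n → ℝ)) × (Fin n → ℝ)) => f z.1.1) ?_ (by fun_prop)
    exact DefMap.comp hf (f := fun z : ((X × (Fin n → ℝ)) × (Fin n → ℝ)) × (Fin n → ℝ) =>
      (z.1.1.1, z.2)) (by fun_prop)
  | succ r ih =>
    refine DefPred.congr (fun p => contDiffAt_succ_iff_pderiv.symm) (DefPred.and ?_ ?_)
    · refine DefPred.eventually (DefPred.forall_finite fun i => ?_) (by fun_prop)
      exact (DefPred.hasPderiv hf i).comp
        (f := fun z : (X × (Fin n → ℝ)) × (Fin n → ℝ) => (z.1.1, z.2)) (by fun_prop)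
    · exact DefPred.forall_finite fun i =>
        ih (f := fun x => Paper.pderiv i (f x)) (DefMap.pderiv hf i)

variable [hO : Fact (LocallyOMinimal L)]

theorem monotoneOn_of_eventually_le {f : ℝ → ℝ} {a b : ℝ} (hf : ContinuousOn f (Ioo a b))
    (h : ∀ x ∈ Ioo a b, ∀ᶠ y in 𝓝[>] x, f x ≤ f y) : MonotoneOn f (Ioo a b) := by
  intro x hx y hy hxy
  have hsub : Icc x y ⊆ Ioo a b := fun z hz => ⟨hx.1.trans_le hz.1, hz.2.trans_lt hy.2⟩
  have hcl : IsClosed ({z | f x ≤ f z} ∩ Icc x y) := by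
    rw [inter_comm]
    exact (hf.mono hsub).preimage_isClosed_of_isClosed isClosed_Icc isClosed_Ici
  refine hcl.Icc_subset_of_forall_exists_gt (show f x ≤ f x from le_rfl) ?_ ⟨hxy, le_rfl⟩
  intro z hz w hw
  obtain ⟨t, ht1, ht2⟩ := ((h z (hsub ⟨hz.2.1, hz.2.2.le⟩)).and
    (Ioc_mem_nhdsGT (show z < w from hw))).exists
  exact ⟨t, le_trans hz.1 ht1, ht2⟩

theorem MonotoneOn.exists_differentiableAt {f : ℝ → ℝ} {a b : ℝ} (hab : a < b)
    (hf : MonotoneOn f (Ioo a b)) : ∃ x ∈ Ioo a b, DifferentiableAt ℝ f x := by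
  by_contra! hcon
  have h0 : MeasureTheory.volume (Ioo a b) = 0 := by
    refine MeasureTheory.measure_mono_null (fun x hx => ?_)
      (MeasureTheory.ae_iff.1 hf.ae_differentiableWithinAt_of_mem)
    exact fun h => hcon x hx ((h hx).differentiableAt (Ioo_mem_nhds hx.1 hx.2))
  rw [Real.volume_Ioo, ENNReal.ofReal_eq_zero] at h0
  linarith

theorem exists_differentiableAt {f : ℝ → ℝ} (hfd : DefMap L f) {a b : ℝ} (hab : a < b)
    (hf : ContinuousOn f (Ioo a b)) : ∃ x ∈ Ioo a b, DifferentiableAt ℝ f x := by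
  have hP : DefPred L fun x : ℝ => ∃ δ : ℝ, 0 < δ ∧ ∀ y, x < y → y < x + δ → f x ≤ f y := by
    fun_prop
  obtain ⟨c, d, hac, hcd, hdb, h⟩ := DefPred.exists_Ioo hP hab
  have hsub : Ioo c d ⊆ Ioo a b := Ioo_subset_Ioo hac.le hdb.le
  rcases h with h | h
  · obtain ⟨x, hx, hd⟩ := MonotoneOn.exists_differentiableAt hcd
      (monotoneOn_of_eventually_le (hf.mono hsub) fun x hx => by
        obtain ⟨δ, hδ, h'⟩ := h x hx
        exact Filter.mem_of_superset (Ioo_mem_nhdsGT (show x < x + δ by linarith))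
          fun y hy => h' y hy.1 hy.2)
    exact ⟨x, hsub hx, hd⟩
  · obtain ⟨x, hx, hd⟩ := MonotoneOn.exists_differentiableAt (f := fun x => -f x) hcd
      (monotoneOn_of_eventually_le (hf.mono hsub).neg fun x hx => by
        have hPx : DefPred L fun y => f x ≤ f y := by fun_prop
        rcases hPx.eventually_or_eventually_not x with h1 | h1
        · obtain ⟨u, hu, hu'⟩ := mem_nhdsGT_iff_exists_Ioo_subset.1 h1
          exact absurd ⟨u - x, sub_pos.2 hu, fun y hy1 hy2 => hu' ⟨hy1, by linarith⟩⟩ (h x hx)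
        · exact h1.mono fun y hy => neg_le_neg (not_le.1 hy).le)
    exact ⟨x, hsub hx, by simpa using hd.neg⟩

theorem exists_isOpen_forall_of_finite {Y ι : Type*} [TopologicalSpace Y] [Finite ι]
    {Q : ι → Y → Prop} {U : Set Y} (hU : IsOpen U) (hUne : U.Nonempty)
    (h : ∀ i, ∀ U' ⊆ U, IsOpen U' → U'.Nonempty →
      ∃ V ⊆ U', IsOpen V ∧ V.Nonempty ∧ ∀ x ∈ V, Q i x) :
    ∃ V ⊆ U, IsOpen V ∧ V.Nonempty ∧ ∀ x ∈ V, ∀ i, Q i x := by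
  classical
  have := Fintype.ofFinite ι
  have key : ∀ S : Finset ι, ∃ V ⊆ U, IsOpen V ∧ V.Nonempty ∧ ∀ x ∈ V, ∀ i ∈ S, Q i x := by
    intro S
    induction S using Finset.induction_on with
    | empty => exact ⟨U, Subset.rfl, hU, hUne, by simp⟩
    | insert k S _ ih =>
      obtain ⟨V, hVU, hV, hVne, hVQ⟩ := ih
      obtain ⟨W, hWV, hW, hWne, hWQ⟩ := h k V hVU hV hVne
      refine ⟨W, hWV.trans hVU, hW, hWne, fun x hx i hi => ?_⟩
      rcases Finset.mem_insert.1 hi with rfl | hi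
      · exact hWQ x hx
      · exact hVQ x (hWV hx) i hi
  simpa using key Finset.univ

/-- A definable function is generically of class `C^r`. -/
theorem exists_isOpen_contDiffAt {f : (Fin n → ℝ) → ℝ} (hf : DefMap L f) (r : ℕ)
    {U : Set (Fin n → ℝ)} (hU : IsOpen U) (hUne : U.Nonempty) :
    ∃ V ⊆ U, IsOpen V ∧ V.Nonempty ∧ ∀ x ∈ V, ContDiffAt ℝ r f x := by
  have hf' : DefMap L fun p : ℝ × (Fin n → ℝ) => f p.2 := by fun_prop
  induction r generalizing f U with
  | zero =>
    obtain ⟨V, hVU, hV, hVne, h⟩ := hf.exists_isOpen_continuousAt hU hUne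
    exact ⟨V, hVU, hV, hVne, fun x hx =>
      contDiffAt_zero_iff_eventually.2 (Filter.mem_of_superset (hV.mem_nhds hx) h)⟩
  | succ r ih =>
    obtain ⟨U₁, hU₁, hU₁o, hU₁ne, hcont⟩ := hf.exists_isOpen_continuousAt hU hUne
    obtain ⟨U₂, hU₂, hU₂o, hU₂ne, hpd⟩ := exists_isOpen_forall_of_finite
      (Q := fun i => HasPderiv i f) hU₁o hU₁ne fun i U' hU' hU'o hU'ne => by
        refine DefPred.exists_isOpen_subset (L := L) (P := HasPderiv i f) ?_ hU'o hU'ne ?_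
        · exact (DefPred.hasPderiv (f := fun _ : ℝ => f) hf' i).comp
            (f := fun x => ((0 : ℝ), x)) (by fun_prop)
        intro V hV hVo ⟨x, hx⟩
        have hline : Continuous fun t : ℝ => x + t • (Pi.single i 1 : Fin n → ℝ) := by fun_prop
        obtain ⟨δ, hδ, hball⟩ := Metric.isOpen_iff.1 (hVo.preimage hline) 0 (by simpa using hx)
        rw [Real.ball_eq_Ioo, zero_sub, zero_add] at hball
        obtain ⟨t, ht, hdt⟩ := exists_differentiableAt (L := L)
          (f := fun t => f (x + t • Pi.single i 1)) (by fun_prop) (show -δ < δ by linarith)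
          (fun t ht => (ContinuousAt.comp (f := fun t => x + t • Pi.single i 1)
            (hcont _ (hU' (hV (hball ht)))) hline.continuousAt).continuousWithinAt)
        refine ⟨_, hball ht, ?_⟩
        have h2 : DifferentiableAt ℝ (fun s => s + t) (0 : ℝ) := by fun_prop
        have h3 := DifferentiableAt.comp (0 : ℝ) (g := fun t => f (x + t • Pi.single i 1))
          (by simpa using hdt) h2
        refine h3.congr_of_eventuallyEq (Filter.Eventually.of_forall fun s => ?_)
        simp only [Function.comp_apply, add_smul]
        congr 1
        abel
    obtain ⟨V, hV, hVo, hVne, hVr⟩ := exists_isOpen_forall_of_finite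
      (Q := fun i => ContDiffAt ℝ r (pderiv i f)) hU₂o hU₂ne fun i U' hU' hU'o hU'ne =>
        have := (DefMap.pderiv (f := fun _ : ℝ => f) hf' i).comp
            (f := fun x => ((0 : ℝ), x)) (by fun_prop)
        ih this hU'o hU'ne (by fun_prop)
    exact ⟨V, hV.trans (hU₂.trans hU₁), hVo, hVne, fun x hx => contDiffAt_succ_iff_pderiv.2
      ⟨Filter.mem_of_superset (hU₂o.mem_nhds (hV hx)) hpd, hVr x hx⟩⟩

end DefinableCalculus

section Germs

variable {L : FirstOrder.Language.{u, v}} [L.Structure ℝ] [hF : Fact (ExpandsOrderedField L)]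

theorem DefMap.iteratedDeriv {f : ℝ → ℝ} (hf : DefMap L f) (j : ℕ) :
    DefMap L (iteratedDeriv j f) := by
  induction j with
  | zero => simpa using hf
  | succ j ih =>
    rw [iteratedDeriv_succ]
    exact DefMap.deriv (f := fun _ : ℝ => _root_.iteratedDeriv j f) (ih.comp DefMap.snd) DefMap.id

variable [hO : Fact (LocallyOMinimal L)]

theorem eventually_contDiffOn_Ioo {f : ℝ → ℝ} (hf : DefMap L f) (r : ℕ) :
    ∀ᶠ δ in 𝓝[>] (0 : ℝ), ContDiffOn ℝ r f (Ioo 0 δ) := by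
  set F : (Fin 1 → ℝ) → ℝ := fun x => f (x 0) with hFdef
  have hFd : DefMap L F := by fun_prop
  have hlift : ContDiff ℝ r fun t : ℝ => (fun _ => t : Fin 1 → ℝ) := by fun_prop
  have hP : DefPred L fun t : ℝ => ContDiffAt ℝ r F fun _ => t :=
    (DefPred.contDiffAt (f := fun _ : ℝ => F) (by fun_prop) r).comp
      (f := fun t : ℝ => ((0 : ℝ), (fun _ => t : Fin 1 → ℝ))) (by fun_prop)
  rcases hP.eventually_or_eventually_not 0 with h | h
  · obtain ⟨δ, hδ, hsub⟩ := mem_nhdsGT_iff_exists_Ioo_subset.1 h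
    filter_upwards [Ioo_mem_nhdsGT hδ] with ε hε t ht
    have h' : ContDiffAt ℝ r F (fun _ => t) := hsub ⟨ht.1, ht.2.trans hε.2⟩
    exact (ContDiffAt.comp (f := fun t : ℝ => (fun _ => t : Fin 1 → ℝ)) t h'
      hlift.contDiffAt).contDiffWithinAt
  · exfalso
    obtain ⟨δ, hδ, hsub⟩ := mem_nhdsGT_iff_exists_Ioo_subset.1 h
    obtain ⟨V, hV, -, ⟨x, hx⟩, hVr⟩ := exists_isOpen_contDiffAt hFd r
      (U := {x | x 0 ∈ Ioo 0 δ}) (isOpen_Ioo.preimage (continuous_apply 0))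
      ⟨fun _ => δ / 2, half_pos hδ, half_lt_self hδ⟩
    refine hsub (hV hx) ?_
    convert hVr x hx using 1
    ext i
    rw [Subsingleton.elim i 0]

theorem eventually_monotoneOn_or_antitoneOn {f : ℝ → ℝ} (hf : DefMap L f) :
    ∀ᶠ δ in 𝓝[>] (0 : ℝ), MonotoneOn f (Ioo 0 δ) ∨ AntitoneOn f (Ioo 0 δ) := by
  have hd : DefMap L (deriv f) := by simpa using hf.iteratedDeriv 1
  have hP : DefPred L fun t => 0 ≤ deriv f t := by fun_prop
  have h1 := eventually_contDiffOn_Ioo hf 1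
  rcases hP.eventually_or_eventually_not 0 with h | h
  all_goals
    obtain ⟨δ, hδ, hsub⟩ := mem_nhdsGT_iff_exists_Ioo_subset.1 h
    filter_upwards [h1, Ioo_mem_nhdsGT hδ] with ε hε hεδ
  · refine Or.inl (monotoneOn_of_deriv_nonneg (convex_Ioo _ _) hε.continuousOn ?_ ?_)
    · exact (hε.differentiableOn (by simp)).mono interior_subset
    · intro x hx
      rw [interior_Ioo] at hx
      exact hsub ⟨hx.1, hx.2.trans hεδ.2⟩
  · refine Or.inr (antitoneOn_of_deriv_nonpos (convex_Ioo _ _) hε.continuousOn ?_ ?_)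
    · exact (hε.differentiableOn (by simp)).mono interior_subset
    · intro x hx
      rw [interior_Ioo] at hx
      exact (not_le.1 (hsub ⟨hx.1, hx.2.trans hεδ.2⟩)).le

omit hF hO L in
theorem abs_deriv_le_of_monotoneOn_or_antitoneOn {g : ℝ → ℝ} {δ t B : ℝ}
    (hg : DifferentiableOn ℝ g (Ioo 0 δ))
    (hm : MonotoneOn (deriv g) (Ioo 0 δ) ∨ AntitoneOn (deriv g) (Ioo 0 δ)) (ht : 0 < t)
    (htδ : 2 * t < δ) (hB : ∀ s ∈ Icc (t / 2) (2 * t), |g s| ≤ B) : |deriv g t| ≤ 4 * B / t := by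
  have hB0 : 0 ≤ B := (abs_nonneg _).trans (hB t ⟨by linarith, by linarith⟩)
  have htm : t ∈ Ioo 0 δ := ⟨ht, by linarith⟩
  have mvt : ∀ a b, t / 2 ≤ a → a < b → b ≤ 2 * t → b - a ≥ t / 2 →
      ∃ s ∈ Ioo a b, |deriv g s| ≤ 4 * B / t := by
    intro a b ha hab hb hba
    have hsub : Icc a b ⊆ Ioo 0 δ := fun x hx => ⟨by linarith [hx.1], by linarith [hx.2]⟩
    obtain ⟨s, hs, hs'⟩ := exists_deriv_eq_slope g hab (hg.continuousOn.mono hsub)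
      (hg.mono (Ioo_subset_Icc_self.trans hsub))
    refine ⟨s, hs, ?_⟩
    rw [hs', abs_div, abs_of_pos (sub_pos.2 hab), div_le_div_iff₀ (sub_pos.2 hab) ht]
    have h1 := hB b ⟨by linarith, hb⟩
    have h2 := hB a ⟨ha, by linarith⟩
    have h3 : |g b - g a| ≤ 2 * B := (abs_sub _ _).trans (by linarith)
    nlinarith
  obtain ⟨s, hs, hs'⟩ := mvt t (2 * t) (by linarith) (by linarith) le_rfl (by linarith)
  obtain ⟨s₂, hs₂, hs₂'⟩ := mvt (t / 2) t le_rfl (by linarith) (by linarith) (by linarith)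
  have hsm : s ∈ Ioo 0 δ := ⟨by linarith [hs.1], by linarith [hs.2]⟩
  have hsm₂ : s₂ ∈ Ioo 0 δ := ⟨by linarith [hs₂.1], by linarith [hs₂.2]⟩
  rw [abs_le] at hs' hs₂' ⊢
  rcases hm with hm | hm
  · have h1 := hm htm hsm hs.1.le
    have h2 := hm hsm₂ htm hs₂.2.le
    constructor <;> linarith
  · have h1 := hm htm hsm hs.1.le
    have h2 := hm hsm₂ htm hs₂.2.le
    constructor <;> linarith

omit hF hO L in
theorem exists_abs_iteratedDeriv_le {g : ℝ → ℝ} {δ : ℝ} {r : ℕ} (hmono : MonotoneOn g (Ioi 0))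
    (hpos : ∀ t > 0, 0 ≤ g t) (hg : ContDiffOn ℝ r g (Ioo 0 δ))
    (hm : ∀ j ≤ r, MonotoneOn (iteratedDeriv j g) (Ioo 0 δ) ∨
      AntitoneOn (iteratedDeriv j g) (Ioo 0 δ)) {j : ℕ} (hj : j ≤ r) :
    ∃ C > 0, ∀ t > 0, 2 ^ j * t < δ → |iteratedDeriv j g t| ≤ C / t ^ j * g (2 ^ j * t) := by
  induction j with
  | zero => exact ⟨1, one_pos, fun t ht _ => by simp [abs_of_nonneg (hpos t ht)]⟩
  | succ j ih =>
    obtain ⟨C, hC, h⟩ := ih (by omega)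
    refine ⟨4 * (C * 2 ^ j), by positivity, fun t ht htδ => ?_⟩
    have hp : (1 : ℝ) ≤ 2 ^ j := one_le_pow₀ (by norm_num)
    rw [pow_succ] at htδ
    rw [iteratedDeriv_succ]
    have hd : DifferentiableOn ℝ (iteratedDeriv j g) (Ioo 0 δ) := by
      have := hg.differentiableOn_iteratedDerivWithin (m := j) (by exact_mod_cast hj)
        isOpen_Ioo.uniqueDiffOn
      exact this.congr fun x hx => (iteratedDerivWithin_of_isOpen isOpen_Ioo hx).symm
    have := abs_deriv_le_of_monotoneOn_or_antitoneOn (B := C * 2 ^ j / t ^ j * g (2 ^ (j + 1) * t))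
      hd (by simpa [iteratedDeriv_succ] using hm (j + 1) hj) ht (by nlinarith) fun s hs => by
        have hs0 : 0 < s := by linarith [hs.1]
        refine (h s hs0 (by nlinarith [hs.2])).trans ?_
        have h1 : g (2 ^ j * s) ≤ g (2 ^ (j + 1) * t) := by
          refine hmono (show (0 : ℝ) < _ by positivity) (show (0 : ℝ) < _ by positivity) ?_
          rw [pow_succ]
          nlinarith [hs.2]
        have h2 : C / s ^ j ≤ C * 2 ^ j / t ^ j := by
          rw [div_le_div_iff₀ (by positivity) (by positivity), mul_assoc, ← mul_pow]
          have : t ^ j ≤ (2 * s) ^ j := pow_le_pow_left₀ ht.le (by linarith [hs.1]) j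
          gcongr
        have h3 : 0 ≤ g (2 ^ j * s) := hpos _ (by positivity)
        gcongr
    refine this.trans (le_of_eq ?_)
    field_simp
    ring

/-- The function `φ` is of class `C^s` on `(0, δ)` and its derivatives up to order `s`
are dominated by `t² / h t`. -/
def Flat (s : ℕ) (h : ℝ → ℝ) (δ : ℝ) (φ : ℝ → ℝ) : Prop :=
  ContDiffOn ℝ s φ (Ioo 0 δ) ∧
    ∀ j ≤ s, ∀ t ∈ Ioo 0 δ, |iteratedDeriv j φ t| * h t ≤ t ^ 2

omit hF hO L in
theorem Flat.deriv {s : ℕ} {h φ : ℝ → ℝ} {δ : ℝ} (hφ : Flat (s + 1) h δ φ) :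
    Flat s h δ (deriv φ) := by
  refine ⟨((contDiffOn_succ_iff_deriv_of_isOpen isOpen_Ioo).1 hφ.1).2.2, fun j hj t ht => ?_⟩
  rw [← iteratedDeriv_succ']
  exact hφ.2 (j + 1) (by omega) t ht

omit hF hO L in
theorem Flat.mono {s s' : ℕ} {h h' φ : ℝ → ℝ} {δ : ℝ} (hφ : Flat s h δ φ) (hs : s' ≤ s)
    (hh : ∀ t > 0, h' t ≤ h t) : Flat s' h' δ φ :=
  ⟨hφ.1.of_le (by exact_mod_cast hs), fun j hj t ht =>
    (mul_le_mul_of_nonneg_left (hh t ht.1) (abs_nonneg _)).trans (hφ.2 j (hj.trans hs) t ht)⟩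

/-- There are definable positive functions which are arbitrarily flat at `0`. -/
theorem exists_flat {h : ℝ → ℝ} (hh : DefMap L h) (hanti : AntitoneOn h (Ioi 0))
    (h1 : ∀ t > 0, 1 ≤ h t) (r : ℕ) :
    ∃ δ > 0, δ ≤ 1 ∧ ∃ φ : ℝ → ℝ, DefMap L φ ∧ (∀ t ∈ Ioo 0 δ, 0 < φ t) ∧ Flat r h δ φ := by
  set g : ℝ → ℝ := fun t => (h (t / 2 ^ r))⁻¹ with hg
  have hgd : DefMap L g := by fun_prop
  have hgmono : MonotoneOn g (Ioi 0) := fun x hx y hy hxy => by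
    have hx' : 0 < x / 2 ^ r := div_pos hx (by positivity)
    have hy' : 0 < y / 2 ^ r := div_pos hy (by positivity)
    refine inv_anti₀ (by linarith [h1 _ hy']) (hanti hx' hy' ?_)
    gcongr
  have hgpos : ∀ t > 0, 0 < g t := fun t ht =>
    inv_pos.2 (by linarith [h1 (t / 2 ^ r) (by positivity)])
  have hev : ∀ᶠ δ in 𝓝[>] (0 : ℝ), ContDiffOn ℝ r g (Ioo 0 δ) ∧ ∀ j ∈ Finset.range (r + 1),
      MonotoneOn (iteratedDeriv j g) (Ioo 0 δ) ∨ AntitoneOn (iteratedDeriv j g) (Ioo 0 δ) :=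
    (eventually_contDiffOn_Ioo hgd r).and ((Filter.eventually_all_finset _).2 fun j _ =>
      eventually_monotoneOn_or_antitoneOn (hgd.iteratedDeriv j))
  obtain ⟨δ₀, ⟨hgr, hgm⟩, hδ₀⟩ := (hev.and self_mem_nhdsWithin).exists
  have hbd : ∀ j, ∃ C > 0, j ≤ r → ∀ t > 0, 2 ^ j * t < δ₀ →
      |iteratedDeriv j g t| ≤ C / t ^ j * g (2 ^ j * t) := by
    intro j
    by_cases hj : j ≤ r
    · obtain ⟨C, hC, h⟩ := exists_abs_iteratedDeriv_le hgmono (fun t ht => (hgpos t ht).le) hgr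
        (fun j hj => hgm j (Finset.mem_range.2 (by omega))) hj
      exact ⟨C, hC, fun _ => h⟩
    · exact ⟨1, one_pos, fun h => absurd h hj⟩
  choose C hC hbd using hbd
  set D : ℕ → ℝ := fun i => |∏ k ∈ Finset.range i, (((r + 3 : ℕ) : ℝ) - k)| with hD
  set K : ℕ → ℝ := fun j => ∑ i ∈ Finset.range (j + 1), (j.choose i : ℝ) * D i * C (j - i) with hK
  set M : ℝ := 1 + ∑ j ∈ Finset.range (r + 1), K j with hM
  have hK0 : ∀ j, 0 ≤ K j := fun j => Finset.sum_nonneg fun i _ => by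
    have := hC (j - i)
    positivity
  have hM1 : 1 ≤ M := by
    have := Finset.sum_nonneg (fun j (_ : j ∈ Finset.range (r + 1)) => hK0 j)
    linarith
  have h2r : (1 : ℝ) ≤ 2 ^ r := one_le_pow₀ (by norm_num)
  refine ⟨min (δ₀ / 2 ^ r) (1 / M), by positivity, (min_le_right _ _).trans
    ((div_le_one (by positivity)).2 hM1), fun t => t ^ (r + 3) * g t, by fun_prop,
    fun t ht => mul_pos (pow_pos ht.1 _) (hgpos t ht.1), ?_, ?_⟩
  · refine ContDiffOn.mul (by fun_prop) (hgr.mono (Ioo_subset_Ioo_right ?_))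
    exact (min_le_left _ _).trans (div_le_self hδ₀.le h2r)
  · intro j hj t ht
    have ht0 : 0 < t := ht.1
    have htr : 2 ^ r * t < δ₀ := by
      have := ht.2.trans_le (min_le_left _ _)
      rwa [lt_div_iff₀ (by positivity), mul_comm] at this
    have htM : M * t ≤ 1 := by
      have := ht.2.trans_le (min_le_right _ _)
      rw [lt_div_iff₀ (by positivity)] at this
      linarith
    have ht1 : t ≤ 1 := by nlinarith
    have htδ : t ∈ Ioo 0 δ₀ := ⟨ht0, by nlinarith⟩
    have hgt : ContDiffAt ℝ j g t := ((hgr t htδ).contDiffAt (isOpen_Ioo.mem_nhds htδ)).of_le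
      (by exact_mod_cast hj)
    have hmain : |iteratedDeriv j (fun t => t ^ (r + 3) * g t) t| ≤ K j * t ^ 3 * (h t)⁻¹ := by
      have := iteratedDeriv_mul (n := j) (f := fun t : ℝ => t ^ (r + 3)) (g := g) (x := t)
        (by fun_prop) hgt
      change |iteratedDeriv j ((fun t : ℝ => t ^ (r + 3)) * g) t| ≤ _
      rw [this, hK, Finset.sum_mul, Finset.sum_mul]
      refine (Finset.abs_sum_le_sum_abs _ _).trans (Finset.sum_le_sum fun i hi => ?_)
      have hij : i ≤ j := by simpa [Nat.lt_succ_iff] using hi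
      rw [iteratedDeriv_eq_iterate (n := i), iter_deriv_pow, abs_mul, abs_mul, abs_mul,
        Nat.abs_cast, abs_of_nonneg (pow_nonneg ht0.le _)]
      have hle : j - i ≤ r := by omega
      have hpow : (2 : ℝ) ^ (j - i) ≤ 2 ^ r := pow_le_pow_right₀ (by norm_num) hle
      have hb := hbd (j - i) hle t ht0 (lt_of_le_of_lt (by gcongr) htr)
      have hgle : g (2 ^ (j - i) * t) ≤ (h t)⁻¹ := by
        have := hgmono (show (0 : ℝ) < 2 ^ (j - i) * t by positivity)
          (show (0 : ℝ) < 2 ^ r * t by positivity) (by gcongr)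
        refine this.trans (le_of_eq ?_)
        rw [hg]
        simp only
        rw [mul_div_cancel_left₀ _ (by positivity)]
      have hb' : t ^ (r + 3 - i) * |iteratedDeriv (j - i) g t| ≤ C (j - i) * t ^ 3 * (h t)⁻¹ := by
        have hh0 : 0 ≤ (h t)⁻¹ := inv_nonneg.2 (by linarith [h1 t ht0])
        have hCj := (hC (j - i)).le
        calc _ ≤ t ^ (r + 3 - i) * (C (j - i) / t ^ (j - i) * (h t)⁻¹) := by
              gcongr
              exact hb.trans (by gcongr)
          _ = C (j - i) * t ^ (r - j) * t ^ 3 * (h t)⁻¹ := by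
              have : r + 3 - i = (j - i) + ((r - j) + 3) := by omega
              rw [this, pow_add, pow_add]
              field_simp
          _ ≤ C (j - i) * 1 * t ^ 3 * (h t)⁻¹ := by
              gcongr
              exact pow_le_one₀ ht0.le ht1
          _ = _ := by ring
      calc _ = (j.choose i : ℝ) * D i * (t ^ (r + 3 - i) * |iteratedDeriv (j - i) g t|) := by
            simp only [hD]; ring
        _ ≤ (j.choose i : ℝ) * D i * (C (j - i) * t ^ 3 * (h t)⁻¹) := by
            gcongr
        _ = _ := by ring
    have hht : 0 < h t := by linarith [h1 t ht0]
    have hKM : K j ≤ M := by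
      have := Finset.single_le_sum (fun j (_ : j ∈ Finset.range (r + 1)) => hK0 j)
        (Finset.mem_range.2 (Nat.lt_succ_of_le hj))
      linarith
    calc _ ≤ K j * t ^ 3 * (h t)⁻¹ * h t := by gcongr
      _ = K j * t * t ^ 2 := by field_simp
      _ ≤ M * t * t ^ 2 := by gcongr
      _ ≤ 1 * t ^ 2 := by gcongr
      _ = t ^ 2 := one_mul _

end Germs

section FlatExtension

variable {L : FirstOrder.Language.{u, v}} [L.Structure ℝ] [hF : Fact (ExpandsOrderedField L)]

/-- A definable function which is bounded on every set `{y ∈ S | t ≤ k y}` is dominated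
by a definable antitone function of `k`. -/
theorem exists_antitoneOn_majorant {Y : Type} [RealTuple Y] {S : Set Y} {k m : Y → ℝ}
    (hS : DefSet L S) (hk : DefMap L k) (hm : DefMap L m)
    (hbd : ∀ t > 0, ∃ B, ∀ y ∈ S, t ≤ k y → m y ≤ B) :
    ∃ h : ℝ → ℝ, DefMap L h ∧ AntitoneOn h (Ioi 0) ∧ (∀ t > 0, 1 ≤ h t) ∧
      ∀ y ∈ S, 0 < k y → m y ≤ h (k y) := by
  set Q : ℝ → ℝ → Prop := fun t s => 0 ≤ s ∧ ∀ y, y ∈ S → t ≤ k y → m y ≤ s with hQ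
  have hQd : DefPred L fun p : ℝ × ℝ => Q p.1 p.2 := by
    have : DefPred L fun p : Y => p ∈ S := hS
    fun_prop (disch := assumption)
  have hbb : ∀ t, BddBelow {s | Q t s} := fun t => ⟨0, fun s hs => hs.1⟩
  have hne : ∀ t > 0, {s | Q t s}.Nonempty := fun t ht => by
    obtain ⟨B, hB⟩ := hbd t ht
    exact ⟨max B 0, le_max_right _ _, fun y hy hty => (hB y hy hty).trans (le_max_left _ _)⟩
  have hinf := DefMap.csInf hQd hbb
  refine ⟨fun t => 1 + sInf {s | Q t s}, by fun_prop, fun t ht t' ht' htt' => ?_,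
    fun t ht => ?_, fun y hy hky => ?_⟩
  · have := csInf_le_csInf (hbb t') (hne t ht) fun s hs =>
      (⟨hs.1, fun y hy hty => hs.2 y hy (htt'.trans hty)⟩ : Q t' s)
    simpa using this
  · have := le_csInf (hne t ht) fun s hs => hs.1
    simpa using this
  · have := le_csInf (hne _ hky) fun s hs => hs.2 y hy le_rfl
    simp only
    linarith

variable {n : ℕ}

/-- A definable function `k` of class `C^s` with values in `[0, 1)` that tends to `0`
at infinity. -/
structure IsGauge (L : FirstOrder.Language.{u, v}) [L.Structure ℝ] (s : ℕ)
    (k : (Fin n → ℝ) → ℝ) : Prop where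
  defMap : DefMap L k
  contDiff : ContDiff ℝ s k
  nonneg : ∀ x, 0 ≤ k x
  lt_one : ∀ x, k x < 1
  isCompact : ∀ t > 0, IsCompact {x | t ≤ k x}

omit hF in
theorem IsGauge.of_le {s s' : ℕ} {k : (Fin n → ℝ) → ℝ} (hk : IsGauge L s k) (h : s' ≤ s) :
    IsGauge L s' k :=
  ⟨hk.1, hk.2.of_le (by exact_mod_cast h), hk.3, hk.4, hk.5⟩

/-- The function `φ(δ k) M`, extended by `0` to the zero set of `k`. -/
noncomputable def flatMul (k M : (Fin n → ℝ) → ℝ) (δ : ℝ) (φ : ℝ → ℝ) (x : Fin n → ℝ) : ℝ :=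
  open Classical in if 0 < k x then φ (δ * k x) * M x else 0

omit hF in
theorem IsGauge.mem_Ioo {s : ℕ} {k : (Fin n → ℝ) → ℝ} (hk : IsGauge L s k) {δ : ℝ}
    (hδ : 0 < δ) {x : Fin n → ℝ} (hx : 0 < k x) : δ * k x ∈ Ioo 0 δ :=
  ⟨by positivity, by nlinarith [hk.lt_one x]⟩

omit hF in
theorem IsGauge.isOpen_pos {s : ℕ} {k : (Fin n → ℝ) → ℝ} (hk : IsGauge L s k) :
    IsOpen {x | 0 < k x} :=
  isOpen_lt continuous_const hk.contDiff.continuous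

omit hF in
theorem IsGauge.flatMul_eventuallyEq {s : ℕ} {k : (Fin n → ℝ) → ℝ} (hk : IsGauge L s k)
    (M : (Fin n → ℝ) → ℝ) (δ : ℝ) (φ : ℝ → ℝ) {x : Fin n → ℝ} (hx : 0 < k x) :
    flatMul k M δ φ =ᶠ[𝓝 x] fun y => φ (δ * k y) * M y := by
  filter_upwards [hk.isOpen_pos.mem_nhds hx] with y hy
  exact if_pos hy

omit hF in
theorem IsGauge.contDiffAt_flatMul {s : ℕ} {k M : (Fin n → ℝ) → ℝ} (hk : IsGauge L s k)
    {δ : ℝ} (hδ : 0 < δ) {φ : ℝ → ℝ} (hφ : ContDiffOn ℝ s φ (Ioo 0 δ)) {x : Fin n → ℝ}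
    (hx : 0 < k x) (hM : ContDiffAt ℝ s M x) : ContDiffAt ℝ s (flatMul k M δ φ) x := by
  refine ContDiffAt.congr_of_eventuallyEq ?_ (hk.flatMul_eventuallyEq M δ φ hx)
  have hφx : ContDiffAt ℝ s φ (δ * k x) :=
    hφ.contDiffAt (isOpen_Ioo.mem_nhds (hk.mem_Ioo hδ hx))
  have h1 : ContDiffAt ℝ s (fun y => δ * k y) x := contDiffAt_const.mul hk.contDiff.contDiffAt
  exact (ContDiffAt.comp (f := fun y => δ * k y) x hφx h1).mul hM

omit hF in
theorem IsGauge.abs_flatMul_le {s : ℕ} {k M : (Fin n → ℝ) → ℝ} (hk : IsGauge L s k)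
    {h : ℝ → ℝ} (hanti : AntitoneOn h (Ioi 0)) (hM : ∀ x, 0 < k x → |M x| ≤ h (k x))
    {δ : ℝ} (hδ : 0 < δ) (hδ1 : δ ≤ 1) {φ : ℝ → ℝ} (hφ : Flat s h δ φ) (x : Fin n → ℝ) :
    |flatMul k M δ φ x| ≤ k x ^ 2 := by
  unfold flatMul
  split_ifs with hx
  · have hm := hk.mem_Ioo hδ hx
    have h1 := hφ.2 0 (Nat.zero_le _) _ hm
    have h2 := hanti hm.1 hx (by nlinarith)
    rw [iteratedDeriv_zero] at h1
    rw [abs_mul]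
    calc _ ≤ |φ (δ * k x)| * h (δ * k x) := by
          gcongr
          exact (hM x hx).trans h2
      _ ≤ (δ * k x) ^ 2 := h1
      _ ≤ (1 * k x) ^ 2 := by gcongr
      _ = _ := by ring
  · simpa using sq_nonneg _

theorem IsGauge.exists_majorant {s : ℕ} {k M : (Fin n → ℝ) → ℝ} (hk : IsGauge L s k)
    (hMd : DefMap L M) (hM : ∀ x, 0 < k x → ContinuousAt M x) :
    ∃ h : ℝ → ℝ, DefMap L h ∧ AntitoneOn h (Ioi 0) ∧ (∀ t > 0, 1 ≤ h t) ∧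
      ∀ x, 0 < k x → |M x| ≤ h (k x) := by
  have hkd := hk.defMap
  obtain ⟨h, h1, h2, h3, h4⟩ := exists_antitoneOn_majorant (L := L) (S := univ) (k := k)
    (m := fun x => |M x|) (by simpa [DefSet] using DefPred.const (L := L) True) hkd (by fun_prop)
    fun t ht => by
      have hc : ContinuousOn (fun x => |M x|) {x | t ≤ k x} := fun x hx =>
        (hM x (ht.trans_le hx)).abs.continuousWithinAt
      obtain ⟨B, hB⟩ := ((hk.isCompact t ht).image_of_continuousOn hc).bddAbove
      exact ⟨B, fun y _ hy => hB (mem_image_of_mem _ hy)⟩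
  exact ⟨h, h1, h2, h3, fun x => h4 x (mem_univ x)⟩

omit hF in
theorem hasLineDerivAt_zero_of_abs_le_sq {F k : (Fin n → ℝ) → ℝ} {x : Fin n → ℝ}
    (hk : DifferentiableAt ℝ k x) (hx : k x = 0) (hF : ∀ y, |F y| ≤ k y ^ 2) (w : Fin n → ℝ) :
    HasLineDerivAt ℝ F 0 x w := by
  have h1 : HasDerivAt (fun t : ℝ => k (x + t • w) ^ 2) 0 0 := by
    have := (hk.lineDifferentiableAt (v := w)).hasLineDerivAt
    rw [HasLineDerivAt] at this
    exact (this.pow 2).congr_deriv (by simp [hx])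
  have hFx : F x = 0 := by simpa [hx] using hF x
  rw [HasLineDerivAt, hasDerivAt_iff_isLittleO]
  rw [hasDerivAt_iff_isLittleO] at h1
  refine Asymptotics.IsBigO.trans_isLittleO (.of_bound 1 (.of_forall fun t => ?_)) h1
  simpa [hx, hFx] using hF (x + t • w)

/-- Multiplying by a sufficiently flat function of `k` makes a function which is only
`C^s` off the zero set of `k` globally `C^s`. -/
theorem exists_contDiff_flatMul (s : ℕ) {k M : (Fin n → ℝ) → ℝ} (hk : IsGauge L s k)
    (hMd : DefMap L M) (hM : ∀ x, 0 < k x → ContDiffAt ℝ s M x) :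
    ∃ h : ℝ → ℝ, DefMap L h ∧ AntitoneOn h (Ioi 0) ∧ (∀ t > 0, 1 ≤ h t) ∧
      ∀ δ > 0, δ ≤ 1 → ∀ φ, Flat s h δ φ → ContDiff ℝ s (flatMul k M δ φ) := by
  induction s generalizing M with
  | zero =>
    obtain ⟨h, h1, h2, h3, h4⟩ := hk.exists_majorant hMd fun x hx => (hM x hx).continuousAt
    refine ⟨h, h1, h2, h3, fun δ hδ hδ1 φ hφ => ?_⟩
    simp only [Nat.cast_zero, contDiff_zero, continuous_iff_continuousAt]
    intro x
    rcases (hk.nonneg x).lt_or_eq with hx | hx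
    · exact (hk.contDiffAt_flatMul hδ hφ.1 hx (hM x hx)).continuousAt
    · have hFx : flatMul k M δ φ x = 0 := if_neg hx.symm.le.not_gt
      rw [ContinuousAt, hFx]
      refine squeeze_zero_norm (hk.abs_flatMul_le h2 h4 hδ hδ1 hφ) ?_
      have : Filter.Tendsto (fun y => k y ^ 2) (𝓝 x) (𝓝 (k x ^ 2)) :=
        (hk.contDiff.continuous.pow 2).tendsto x
      rwa [← hx, zero_pow two_ne_zero] at this
  | succ s ih =>
    have hk' := hk.of_le (Nat.le_succ s)
    have hkd := hk.defMap
    have hMp : ∀ i, ∀ x, 0 < k x → ContDiffAt ℝ s (pderiv i M) x := fun i x hx =>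
      (contDiffAt_succ_iff_pderiv.1 (by exact_mod_cast hM x hx)).2 i
    have hkp : ∀ i, ∀ x, ContDiffAt ℝ s (pderiv i k) x := fun i x =>
      (contDiffAt_succ_iff_pderiv.1 (by exact_mod_cast hk.contDiff.contDiffAt)).2 i
    have hMpd : ∀ i, DefMap L (pderiv i M) := fun i =>
      (DefMap.pderiv (f := fun _ : ℝ => M) (by fun_prop) i).comp (f := fun x => ((0 : ℝ), x))
        (by fun_prop)
    have hkpd : ∀ i, DefMap L (pderiv i k) := fun i =>
      (DefMap.pderiv (f := fun _ : ℝ => k) (by fun_prop) i).comp (f := fun x => ((0 : ℝ), x))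
        (by fun_prop)
    obtain ⟨h₀, hd₀, ha₀, hp₀, hb₀⟩ := hk.exists_majorant hMd fun x hx => (hM x hx).continuousAt
    have ih1 := fun i => ih hk' (hMpd i) (hMp i)
    choose h₁ hd₁ ha₁ hp₁ hc₁ using ih1
    have ih2 := fun i => ih hk' (M := fun x => pderiv i k x * M x)
      (by have := hkpd i; fun_prop)
      fun x hx => (hkp i x).mul ((hM x hx).of_le (by exact_mod_cast Nat.le_succ s))
    choose h₂ hd₂ ha₂ hp₂ hc₂ using ih2
    have hpos : ∀ t > 0, ∀ i, 0 ≤ h₁ i t + h₂ i t := fun t ht i => by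
      linarith [hp₁ i t ht, hp₂ i t ht]
    set h : ℝ → ℝ := fun t => h₀ t + ∑ i, (h₁ i t + h₂ i t) with hh
    have hle₀ : ∀ t > 0, h₀ t ≤ h t := fun t ht =>
      le_add_of_nonneg_right (Finset.sum_nonneg fun i _ => hpos t ht i)
    have hle : ∀ t > 0, ∀ i, h₁ i t + h₂ i t ≤ h t := fun t ht i => by
      have := Finset.single_le_sum (fun i _ => hpos t ht i) (Finset.mem_univ i)
      simp only [hh]
      linarith [hp₀ t ht]
    have hhd : DefMap L h := by fun_prop
    have hanti : AntitoneOn h (Ioi 0) := fun x hx y hy hxy =>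
      add_le_add (ha₀ hx hy hxy) (Finset.sum_le_sum fun i _ =>
        add_le_add (ha₁ i hx hy hxy) (ha₂ i hx hy hxy))
    refine ⟨h, hhd, hanti, fun t ht => (hp₀ t ht).trans (hle₀ t ht), fun δ hδ hδ1 φ hφ => ?_⟩
    rw [contDiff_iff_contDiffAt]
    intro x
    have hpd : ∀ y i, HasLineDerivAt ℝ (flatMul k M δ φ)
        (δ * flatMul k (fun x => pderiv i k x * M x) δ (deriv φ) y
          + flatMul k (pderiv i M) δ φ y) y (Pi.single i 1) := by
      intro y i
      rcases (hk.nonneg y).lt_or_eq with hy | hy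
      · have hm := hk.mem_Ioo hδ hy
        have hφ' : HasDerivAt φ (deriv φ (δ * k y)) (δ * k y) :=
          ((hφ.1.differentiableOn (by simp)).differentiableAt (isOpen_Ioo.mem_nhds hm)).hasDerivAt
        have hk1 : HasLineDerivAt ℝ k (pderiv i k y) y (Pi.single i 1) :=
          ((hk.contDiff.differentiable (by simp)) y).lineDifferentiableAt.hasLineDerivAt
        have hM1 : HasLineDerivAt ℝ M (pderiv i M y) y (Pi.single i 1) :=
          ((hM y hy).differentiableAt (by simp)).lineDifferentiableAt.hasLineDerivAt
        have key : HasLineDerivAt ℝ (fun y => φ (δ * k y) * M y)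
            (deriv φ (δ * k y) * (δ * pderiv i k y) * M y + φ (δ * k y) * pderiv i M y)
            y (Pi.single i 1) := by
          rw [HasLineDerivAt] at hk1 hM1 ⊢
          have h2 : HasDerivAt (fun t : ℝ => φ (δ * k (y + t • Pi.single i 1)))
              (deriv φ (δ * k y) * (δ * pderiv i k y)) 0 :=
            HasDerivAt.comp (h₂ := φ) (h := fun t : ℝ => δ * k (y + t • Pi.single i 1)) 0
              (by simpa using hφ') (hk1.const_mul δ)
          exact (h2.mul hM1).congr_deriv (by simp)
        refine (key.congr_of_eventuallyEq (hk.flatMul_eventuallyEq M δ φ hy)).congr_deriv ?_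
        simp only [flatMul, if_pos hy]
        ring
      · have := hasLineDerivAt_zero_of_abs_le_sq (F := flatMul k M δ φ)
          ((hk.contDiff.differentiable (by simp)) y) hy.symm
          (hk.abs_flatMul_le hanti (fun x hx => (hb₀ x hx).trans (hle₀ _ hx)) hδ hδ1 hφ)
          (Pi.single i 1)
        simpa [flatMul, hy.symm.le.not_gt] using this
    have hcast : ((s + 1 : ℕ) : WithTop ℕ∞) = s + 1 := by norm_cast
    rw [hcast, contDiffAt_succ_iff_pderiv]
    refine ⟨.of_forall fun y i => (hpd y i).lineDifferentiableAt, fun i => ?_⟩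
    have : pderiv i (flatMul k M δ φ) = fun y =>
        δ * flatMul k (fun x => pderiv i k x * M x) δ (deriv φ) y
          + flatMul k (pderiv i M) δ φ y := funext fun y => (hpd y i).lineDeriv
    rw [this]
    have c1 := hc₁ i δ hδ hδ1 φ (hφ.mono (Nat.le_succ s) fun t ht => by
      linarith [hle t ht i, hp₂ i t ht])
    have c2 := hc₂ i δ hδ hδ1 (deriv φ) (hφ.deriv.mono le_rfl fun t ht => by
      linarith [hle t ht i, hp₁ i t ht])
    exact ((contDiff_const.mul c2).add c1).contDiffAt

end FlatExtension

section Small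

variable {L : FirstOrder.Language.{u, v}} [L.Structure ℝ] {n d : ℕ}

/-- All coordinate projections of `A` to `ℝ^d` have empty interior. -/
def Small (d : ℕ) (A : Set (Fin n → ℝ)) : Prop :=
  ∀ τ : Fin d → Fin n, interior (coordProj d τ '' A) = ∅

theorem small_succ_self (A : Set (Fin n → ℝ)) : Small (n + 1) A := by
  intro τ
  obtain ⟨i, j, hne, hij⟩ : ∃ i j, i ≠ j ∧ τ i = τ j := by
    by_contra! h
    have : Function.Injective τ := fun i j hij => by_contra fun hne => h i j hne hij
    simpa using Fintype.card_le_of_injective τ this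
  by_contra hcon
  obtain ⟨x, hx⟩ := nonempty_iff_ne_empty.2 hcon
  have hc : ContinuousAt (fun t : ℝ => Function.update x i (x i + t)) 0 := by fun_prop
  have hev : ∀ᶠ t in 𝓝 (0 : ℝ), Function.update x i (x i + t) ∈ coordProj (n + 1) τ '' A :=
    hc.eventually (by
      simp only [add_zero, Function.update_eq_self]
      exact mem_interior_iff_mem_nhds.1 hx)
  have heq : ∀ y ∈ coordProj (n + 1) τ '' A, y i = y j := by
    rintro _ ⟨z, -, rfl⟩
    simp [coordProj, hij]
  have hev' : ∀ᶠ t in 𝓝[>] (0 : ℝ), Function.update x i (x i + t) ∈ coordProj (n + 1) τ '' A :=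
    hev.filter_mono nhdsWithin_le_nhds
  obtain ⟨t, ht, ht0⟩ := (hev'.and self_mem_nhdsWithin).exists
  have h1 := heq _ (interior_subset hx)
  have h2 := heq _ ht
  rw [Function.update_self, Function.update_of_ne hne.symm] at h2
  have : (0 : ℝ) < t := ht0
  linarith

theorem eq_empty_of_small_zero {A : Set (Fin n → ℝ)} (h : Small 0 A) : A = ∅ := by
  have h' := h Fin.elim0
  rw [(isOpen_discrete (coordProj 0 Fin.elim0 '' A)).interior_eq] at h'
  simpa using h'

theorem DefMap.coordProj {X : Type} [RealTuple X] {f : X → Fin n → ℝ} (hf : DefMap L f)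
    (τ : Fin d → Fin n) : DefMap L fun x => coordProj d τ (f x) := by
  unfold Paper.coordProj
  fun_prop

attribute [fun_prop] DefMap.coordProj

@[fun_prop]
theorem continuous_coordProj (τ : Fin d → Fin n) : Continuous (coordProj d τ) := by
  unfold coordProj
  fun_prop

variable [hF : Fact (ExpandsOrderedField L)] [hO : Fact (LocallyOMinimal L)]

/-- For a set whose projections to `ℝ^(d+1)` have empty interior, the generic fibres of its
projections to `ℝ^d` are discrete. -/
theorem Small.exists_isMeagre_forall_isolated {A : Set (Fin n → ℝ)} (hA : DefSet L A)
    (hs : Small (d + 1) A) (τ : Fin d → Fin n) :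
    ∃ M : Set (Fin d → ℝ), IsMeagre M ∧ ∀ z ∈ A, coordProj d τ z ∉ M →
      ∀ᶠ z' in 𝓝 z, z' ∈ A → coordProj d τ z' = coordProj d τ z → z' = z := by
  set Y : Fin n × {q : ℚ × ℚ // q.1 < q.2} → Set (Fin d → ℝ) := fun q =>
    {x | ∀ t : ℝ, q.2.1.1 < t → t < q.2.1.2 → ∃ z, z ∈ A ∧ coordProj d τ z = x ∧ z q.1 = t}
    with hY
  have hAd : DefPred L fun z => z ∈ A := hA
  have hYd : ∀ q, DefSet L (Y q) := fun q => by
    change DefPred L fun x => ∀ t : ℝ, q.2.1.1 < t → t < q.2.1.2 →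
      ∃ z, z ∈ A ∧ coordProj d τ z = x ∧ z q.1 = t
    fun_prop (disch := assumption)
  have hYi : ∀ q, interior (Y q) = ∅ := by
    rintro ⟨i, ⟨a, b⟩, hab⟩
    by_contra hne
    obtain ⟨x, hx⟩ := nonempty_iff_ne_empty.2 hne
    have hab' : (a : ℝ) < b := by exact_mod_cast hab
    obtain ⟨t, ht⟩ := nonempty_Ioo.2 hab'
    set O : Set (Fin (d + 1) → ℝ) :=
      {y | y 0 ∈ Ioo (a : ℝ) b ∧ Fin.tail y ∈ interior (Y (i, ⟨(a, b), hab⟩))}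
    have hOo : IsOpen O := by
      refine (isOpen_Ioo.preimage (continuous_apply 0)).inter (isOpen_interior.preimage ?_)
      unfold Fin.tail
      fun_prop
    have hsub : O ⊆ coordProj (d + 1) (Fin.cons i τ) '' A := by
      rintro y ⟨hy0, hyt⟩
      obtain ⟨z, hzA, hz, hzi⟩ := interior_subset hyt (y 0) hy0.1 hy0.2
      refine ⟨z, hzA, funext fun j => ?_⟩
      refine Fin.cases ?_ (fun j => ?_) j
      · simpa [coordProj] using hzi
      · simpa [coordProj, Fin.tail] using congrFun hz j
    have : (Fin.cons t x : Fin (d + 1) → ℝ) ∈ O := ⟨by simpa using ht, by simpa using hx⟩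
    have := interior_maximal hsub hOo this
    rw [hs] at this
    exact this
  refine ⟨⋃ q, Y q, isMeagre_iUnion fun q => (isNowhereDense_of_defSet (hYd q) (hYi q)).isMeagre,
    fun z hz hzM => ?_⟩
  have key : ∀ i, ∀ᶠ t in 𝓝 (z i), t ≠ z i →
      ¬ ∃ z', z' ∈ A ∧ coordProj d τ z' = coordProj d τ z ∧ z' i = t := by
    intro i
    set P : ℝ → Prop := fun t => ∃ z', z' ∈ A ∧ coordProj d τ z' = coordProj d τ z ∧ z' i = t
    have hP : DefPred L P := by
      have h0 : DefPred L fun p : ℝ × (Fin n → ℝ) => coordProj d τ p.2 = coordProj d τ z := by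
        exact DefPred.eq (by fun_prop) (DefMap.const _)
      fun_prop (disch := assumption)
    have hno : ∀ u w : ℝ, u < w → ¬ ∀ t ∈ Ioo u w, P t := by
      intro u w huw h
      obtain ⟨a, hua, haw⟩ := exists_rat_btwn huw
      obtain ⟨b, hab, hbw⟩ := exists_rat_btwn haw
      refine hzM (mem_iUnion.2 ⟨(i, ⟨(a, b), by exact_mod_cast hab⟩), fun t hat htb => ?_⟩)
      exact h t ⟨hua.trans hat, htb.trans hbw⟩
    obtain ⟨δ, hδ, h1, h2⟩ := exists_Ioo_forall_or_forall_not hO.out hP (z i)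
    replace h1 := h1.resolve_left (hno _ _ (by linarith))
    replace h2 := h2.resolve_left (hno _ _ (by linarith))
    filter_upwards [Ioo_mem_nhds (show z i - δ < z i by linarith) (show z i < z i + δ by linarith)]
      with t ht hne
    rcases hne.lt_or_gt with h | h
    · exact h2 t ⟨ht.1, h⟩
    · exact h1 t ⟨h, ht.2⟩
  have key' : ∀ᶠ z' in 𝓝 z, ∀ i, z' i ≠ z i →
      ¬ ∃ z'', z'' ∈ A ∧ coordProj d τ z'' = coordProj d τ z ∧ z'' i = z' i :=
    Filter.eventually_all.2 fun i => (continuous_apply i).continuousAt.eventually (key i)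
  filter_upwards [key'] with z' hz' hz'A hpr
  by_contra hne
  obtain ⟨i, hi⟩ := Function.ne_iff.1 hne
  exact hz' i hi ⟨z', hz'A, hpr, rfl⟩

/-- An open box with rational vertices. -/
def ratBox (q : (Fin n → ℚ) × (Fin n → ℚ)) : Set (Fin n → ℝ) :=
  {z | ∀ i, (q.1 i : ℝ) < z i ∧ z i < q.2 i}

omit hF hO [L.Structure ℝ] L in
theorem isOpen_ratBox (q : (Fin n → ℚ) × (Fin n → ℚ)) : IsOpen (ratBox q) := by
  simp only [ratBox, ofPred_forall, ofPred_and]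
  exact isOpen_iInter_of_finite fun i => (isOpen_lt (by fun_prop) (by fun_prop)).inter
    (isOpen_lt (by fun_prop) (by fun_prop))

omit hF hO [L.Structure ℝ] L in
theorem exists_ratBox_subset {z : Fin n → ℝ} {U : Set (Fin n → ℝ)} (hU : U ∈ 𝓝 z) :
    ∃ q, z ∈ ratBox q ∧ ratBox q ⊆ U := by
  obtain ⟨ε, hε, hball⟩ := Metric.mem_nhds_iff.1 hU
  choose a ha using fun i => exists_rat_btwn (show z i - ε < z i by linarith)
  choose b hb using fun i => exists_rat_btwn (show z i < z i + ε by linarith)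
  refine ⟨(a, b), fun i => ⟨(ha i).2, (hb i).1⟩, fun y hy => hball ?_⟩
  rw [Metric.mem_ball, dist_pi_lt_iff hε]
  intro i
  have h1 := hy i
  rw [Real.dist_eq, abs_lt]
  constructor <;> linarith [h1.1, h1.2, (ha i).1, (hb i).2]

omit hO in
theorem DefSet.ratBox (q : (Fin n → ℚ) × (Fin n → ℚ)) : DefSet L (ratBox q) := by
  change DefPred L fun z : Fin n → ℝ => ∀ i, (q.1 i : ℝ) < z i ∧ z i < q.2 i
  fun_prop

/-- If a projection of `T ⊆ A` has interior, then some part of `A` contained in `T` is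
locally the graph of a `C^r` map. -/
theorem Small.exists_section {A T : Set (Fin n → ℝ)} (hA : DefSet L A)
    (hs : Small (d + 1) A) (hT : DefSet L T) (hTA : T ⊆ A) (τ : Fin d → Fin n)
    (hTint : (interior (coordProj d τ '' T)).Nonempty) (r : ℕ) :
    ∃ V : Set (Fin d → ℝ), IsOpen V ∧ V.Nonempty ∧ ∃ Q : Set (Fin n → ℝ), IsOpen Q ∧
      ∃ f : (Fin d → ℝ) → Fin n → ℝ, ∀ x ∈ V, ContDiffAt ℝ r f x ∧ f x ∈ T ∧ f x ∈ Q ∧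
        coordProj d τ (f x) = x ∧ ∀ z ∈ A, z ∈ Q → coordProj d τ z = x → z = f x := by
  obtain ⟨M, hM, hiso⟩ := hs.exists_isMeagre_forall_isolated hA τ
  have hAd : DefPred L fun z => z ∈ A := hA
  have hTd : DefPred L fun z => z ∈ T := hT
  set P : (Fin n → ℚ) × (Fin n → ℚ) → (Fin d → ℝ) → (Fin n → ℝ) → Prop := fun q x z =>
    z ∈ T ∧ z ∈ ratBox q ∧ coordProj d τ z = x ∧
      ∀ z', z' ∈ A → z' ∈ ratBox q → coordProj d τ z' = x → z' = z with hP
  have hPd : ∀ q, DefPred L fun p : (Fin d → ℝ) × (Fin n → ℝ) => P q p.1 p.2 := fun q => by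
    have : DefSet L (ratBox q) := DefSet.ratBox q
    fun_prop (disch := assumption)
  obtain ⟨q, V, -, hV, hVne, hVX⟩ := exists_isOpen_subset_of_subset_iUnion
    (S := fun q => {x | ∃ z, P q x z}) (L := L) (fun q => (hPd q).exists) isOpen_interior hTint hM
    (fun x hx => by
      by_cases hxM : x ∈ M
      · exact Or.inl hxM
      obtain ⟨z, hzT, rfl⟩ := interior_subset hx
      obtain ⟨q, hzq, hq⟩ := exists_ratBox_subset (hiso z (hTA hzT) hxM)
      exact Or.inr (mem_iUnion.2 ⟨q, z, hzT, hzq, rfl, fun z' h1 h2 h3 => hq h2 h1 h3⟩))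
  set f : (Fin d → ℝ) → Fin n → ℝ := fun x => uniqueChoice (P q x) 0 with hf
  have hfd : DefMap L f := DefMap.uniqueChoice (hPd q)
  have hfP : ∀ x ∈ V, P q x (f x) := fun x hx => by
    obtain ⟨z, hz⟩ := hVX hx
    exact uniqueChoice_spec ⟨z, hz, fun z' hz' => hz.2.2.2 z' (hTA hz'.1) hz'.2.1 hz'.2.2.1⟩
  obtain ⟨V', hV'V, hV', hV'ne, hfr⟩ := exists_isOpen_forall_of_finite
    (Q := fun i x => ContDiffAt ℝ r (fun x => f x i) x) hV hVne
    fun i U' _ hU' hne => exists_isOpen_contDiffAt (L := L) (by fun_prop) r hU' hne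
  refine ⟨V', hV', hV'ne, ratBox q, isOpen_ratBox q, f, fun x hx => ⟨contDiffAt_pi.2 (hfr x hx),
    ?_⟩⟩
  obtain ⟨h1, h2, h3, h4⟩ := hfP x (hV'V hx)
  exact ⟨h1, h2, h3, h4⟩

end Small

section Tube

theorem hasDerivAt_max_zero_pow (r : ℕ) (t : ℝ) :
    HasDerivAt (fun t : ℝ => max 0 t ^ (r + 2)) ((r + 2) * max 0 t ^ (r + 1)) t := by
  rcases lt_trichotomy t 0 with h | rfl | h
  · rw [max_eq_left h.le]
    refine ((hasDerivAt_const t (0 : ℝ)).congr_of_eventuallyEq ?_).congr_deriv (by simp)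
    filter_upwards [Iio_mem_nhds h] with s hs
    simp [max_eq_left (mem_Iio.1 hs).le]
  · rw [hasDerivAt_iff_isLittleO]
    have h1 : HasDerivAt (fun t : ℝ => t ^ (r + 2)) 0 0 :=
      (hasDerivAt_pow (r + 2) (0 : ℝ)).congr_deriv (by simp)
    rw [hasDerivAt_iff_isLittleO] at h1
    refine Asymptotics.IsBigO.trans_isLittleO (.of_bound 1 (.of_forall fun s => ?_)) h1
    have : |max 0 s| ≤ |s| := by
      rw [abs_of_nonneg (le_max_left _ _)]
      exact max_le (abs_nonneg _) (le_abs_self _)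
    simpa using pow_le_pow_left₀ (abs_nonneg _) this (r + 2)
  · rw [max_eq_right h.le]
    refine ((hasDerivAt_pow (r + 2) t).congr_of_eventuallyEq ?_).congr_deriv (by simp)
    filter_upwards [Ioi_mem_nhds h] with s hs
    simp [max_eq_right (mem_Ioi.1 hs).le]

theorem contDiff_max_zero_pow (r : ℕ) : ContDiff ℝ r fun t : ℝ => max 0 t ^ (r + 1) := by
  induction r with
  | zero =>
    simp only [Nat.cast_zero, contDiff_zero]
    fun_prop
  | succ r ih =>
    have hcast : ((r + 1 : ℕ) : WithTop ℕ∞) = r + 1 := by norm_cast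
    rw [hcast, contDiff_succ_iff_deriv]
    refine ⟨fun t => (hasDerivAt_max_zero_pow r t).differentiableAt, by simp, ?_⟩
    have : deriv (fun t : ℝ => max 0 t ^ (r + 1 + 1)) =
        fun t : ℝ => ((r : ℝ) + 2) * max 0 t ^ (r + 1) :=
      funext fun t => (hasDerivAt_max_zero_pow r t).deriv
    rw [this]
    exact contDiff_const.mul ih

variable {L : FirstOrder.Language.{u, v}} [L.Structure ℝ] {n d : ℕ}

theorem sq_norm_le_sum_sq (x : Fin n → ℝ) : ‖x‖ ^ 2 ≤ ∑ i, x i ^ 2 := by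
  have h : ‖x‖ ≤ √(∑ i, x i ^ 2) := by
    refine (pi_norm_le_iff_of_nonneg (Real.sqrt_nonneg _)).2 fun i => Real.abs_le_sqrt ?_
    exact Finset.single_le_sum (f := fun i => x i ^ 2) (fun i _ => sq_nonneg _)
      (Finset.mem_univ i)
  calc _ ≤ √(∑ i, x i ^ 2) ^ 2 := by gcongr
    _ = _ := Real.sq_sqrt (Finset.sum_nonneg fun i _ => sq_nonneg _)

section

variable [hF : Fact (ExpandsOrderedField L)]

/-- The zero set of a definable `C^r` function is the zero set of a gauge. -/
theorem exists_isGauge {r : ℕ} {k : (Fin n → ℝ) → ℝ} (hkd : DefMap L k) (hk : ContDiff ℝ r k) :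
    ∃ k' : (Fin n → ℝ) → ℝ, IsGauge L r k' ∧ ∀ x, k' x = 0 ↔ k x = 0 := by
  have hs : ∀ x : Fin n → ℝ, 0 ≤ ∑ i, x i ^ 2 := fun x => Finset.sum_nonneg fun i _ => sq_nonneg _
  have hpos : ∀ x, 0 < (1 + k x ^ 2) * (1 + ∑ i, x i ^ 2) := fun x => by
    have := hs x
    positivity
  have hcd : ContDiff ℝ r fun x => k x ^ 2 / ((1 + k x ^ 2) * (1 + ∑ i, x i ^ 2)) :=
    ContDiff.div (by fun_prop) (by fun_prop) fun x => (hpos x).ne'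
  refine ⟨fun x => k x ^ 2 / ((1 + k x ^ 2) * (1 + ∑ i, x i ^ 2)), ⟨by fun_prop, hcd,
    fun x => div_nonneg (sq_nonneg _) (hpos x).le, fun x => ?_, fun t ht => ?_⟩, fun x => ?_⟩
  · rw [div_lt_one (hpos x)]
    nlinarith [hs x, sq_nonneg (k x), mul_nonneg (sq_nonneg (k x)) (hs x)]
  · refine (isCompact_closedBall (0 : Fin n → ℝ) (1 + 1 / t)).of_isClosed_subset
      (isClosed_le continuous_const hcd.continuous) fun x hx => ?_
    have h1 : t ≤ k x ^ 2 / ((1 + k x ^ 2) * (1 + ∑ i, x i ^ 2)) := hx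
    rw [le_div_iff₀ (hpos x)] at h1
    have h2 : t * (1 + ∑ i, x i ^ 2) ≤ 1 := by
      by_contra! h
      nlinarith [sq_nonneg (k x)]
    have h3 : ‖x‖ ^ 2 ≤ 1 / t := by
      rw [le_div_iff₀ ht]
      nlinarith [sq_norm_le_sum_sq x]
    rw [mem_closedBall_zero_iff]
    nlinarith [sq_nonneg (‖x‖ - 1)]
  · simp only [div_eq_zero_iff, (hpos x).ne', or_false]
    exact pow_eq_zero_iff two_ne_zero

theorem DefMap.flatMul {k M : (Fin n → ℝ) → ℝ} (hk : DefMap L k) (hM : DefMap L M) (δ : ℝ)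
    {φ : ℝ → ℝ} (hφ : DefMap L φ) : DefMap L (flatMul k M δ φ) := by
  unfold Paper.flatMul
  fun_prop

end

/-- Near `a ∈ A`, the set `A` is the graph of a `C^r` map over the coordinates chosen by `τ`. -/
def LocalGraph (r : ℕ) (A : Set (Fin n → ℝ)) (τ : Fin d → Fin n) (a : Fin n → ℝ) : Prop :=
  ∃ f : (Fin d → ℝ) → Fin n → ℝ, ContDiffAt ℝ r f (coordProj d τ a) ∧ f (coordProj d τ a) = a ∧
    (∀ᶠ x in 𝓝 (coordProj d τ a), coordProj d τ (f x) = x) ∧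
    ∀ᶠ z in 𝓝 a, (z ∈ A ↔ z = f (coordProj d τ z))

theorem LocalGraph.eventually_mem {A : Set (Fin n → ℝ)} {τ : Fin d → Fin n}
    {f : (Fin d → ℝ) → Fin n → ℝ} {a : Fin n → ℝ} (hf : ContinuousAt f (coordProj d τ a))
    (hfa : f (coordProj d τ a) = a)
    (hfs : ∀ᶠ x in 𝓝 (coordProj d τ a), coordProj d τ (f x) = x)
    (hfA : ∀ᶠ z in 𝓝 a, (z ∈ A ↔ z = f (coordProj d τ z))) :
    ∀ᶠ x in 𝓝 (coordProj d τ a), coordProj d τ (f x) = x ∧ f x ∈ A := by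
  have h : Filter.Tendsto f (𝓝 (coordProj d τ a)) (𝓝 a) := by
    simpa only [ContinuousAt, hfa] using hf
  filter_upwards [hfs, h.eventually hfA] with x h1 h2
  exact ⟨h1, h2.2 (by rw [h1])⟩

theorem exists_separation {r : ℕ} {C K : Set (Fin n → ℝ)} {τ : Fin d → Fin n}
    (hC : ∀ a ∈ C, LocalGraph r C τ a) (hK : IsCompact K) (hKC : K ⊆ C) :
    ∃ η > 0, ∀ a ∈ K, ∀ b ∈ C, coordProj d τ a = coordProj d τ b → a ≠ b → η ≤ ‖a - b‖ := by
  have hU : ∀ a : K, ∃ U : Set (Fin n → ℝ), IsOpen U ∧ (a : Fin n → ℝ) ∈ U ∧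
      ∀ x ∈ U, ∀ y ∈ U, x ∈ C → y ∈ C → coordProj d τ x = coordProj d τ y → x = y := by
    rintro ⟨a, ha⟩
    obtain ⟨f, -, -, -, hf⟩ := hC a (hKC ha)
    obtain ⟨U, hU, hUo, haU⟩ := eventually_nhds_iff.1 hf
    exact ⟨U, hUo, haU, fun x hx y hy hxC hyC hxy => by
      rw [(hU x hx).1 hxC, (hU y hy).1 hyC, hxy]⟩
  choose U hUo haU hUC using hU
  obtain ⟨η, hη, h⟩ := lebesgue_number_lemma_of_metric hK hUo
    fun a ha => mem_iUnion.2 ⟨⟨a, ha⟩, haU _⟩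
  refine ⟨η, hη, fun a ha b hb hab hne => ?_⟩
  by_contra! hlt
  obtain ⟨i, hi⟩ := h a ha
  refine hne (hUC i a (hi (Metric.mem_ball_self hη)) b (hi ?_) (hKC ha) hb hab)
  rwa [Metric.mem_ball, dist_comm, dist_eq_norm]

variable [hF : Fact (ExpandsOrderedField L)] [hO : Fact (LocallyOMinimal L)]

theorem exists_radius {r : ℕ} {C : Set (Fin n → ℝ)} {τ : Fin d → Fin n} (hCd : DefSet L C)
    (hC : ∀ a ∈ C, LocalGraph r C τ a) {k : (Fin n → ℝ) → ℝ} (hk : IsGauge L r k)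
    (hclosed : ∀ t > 0, IsClosed {a | a ∈ C ∧ t ≤ k a}) :
    ∃ ε : (Fin n → ℝ) → ℝ, DefMap L ε ∧ ContDiff ℝ r ε ∧ (∀ x, 0 ≤ ε x) ∧ (∀ x, ε x ≤ 1) ∧
      (∀ x, ε x = 0 ↔ k x = 0) ∧ ∀ a ∈ C, ∀ b ∈ C, coordProj d τ a = coordProj d τ b → a ≠ b →
        4 * ε a ≤ ‖a - b‖ := by
  have hkd := hk.defMap
  have hCd' : DefPred L fun a => a ∈ C := hCd
  obtain ⟨h₁, hd₁, ha₁, hp₁, hb₁⟩ := exists_antitoneOn_majorant (L := L)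
    (S := {p : (Fin n → ℝ) × (Fin n → ℝ) | p.1 ∈ C ∧ p.2 ∈ C ∧
      coordProj d τ p.1 = coordProj d τ p.2 ∧ p.1 ≠ p.2})
    (k := fun p => k p.1) (m := fun p => ‖p.1 - p.2‖⁻¹)
    (by
      change DefPred L fun p : (Fin n → ℝ) × (Fin n → ℝ) => p.1 ∈ C ∧ p.2 ∈ C ∧
        coordProj d τ p.1 = coordProj d τ p.2 ∧ ¬ p.1 = p.2
      fun_prop (disch := assumption)) (by fun_prop) (by fun_prop)
    fun t ht => by
      obtain ⟨η, hη, h⟩ := exists_separation hC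
        ((hk.isCompact t ht).of_isClosed_subset (hclosed t ht) fun a ha => ha.2) fun a ha => ha.1
      refine ⟨η⁻¹, fun p hp htp => ?_⟩
      exact inv_anti₀ hη (h p.1 ⟨hp.1, htp⟩ p.2 hp.2.1 hp.2.2.1 hp.2.2.2)
  obtain ⟨h₀, hd₀, ha₀, hp₀, hb₀⟩ := exists_contDiff_flatMul r hk (M := fun _ => 1)
    (by fun_prop) fun x _ => contDiffAt_const
  have hanti : AntitoneOn (fun t => h₀ t + 4 * h₁ t) (Ioi 0) := fun x hx y hy hxy => by
    have := ha₀ hx hy hxy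
    have := ha₁ hx hy hxy
    simp only
    linarith
  obtain ⟨δ, hδ, hδ1, φ, hφd, hφpos, hφ⟩ := exists_flat (L := L)
    (h := fun t => h₀ t + 4 * h₁ t) (by fun_prop) hanti
    (fun t ht => by linarith [hp₀ t ht, hp₁ t ht]) r
  have hbound : ∀ x, 0 < k x → 0 < φ (δ * k x) ∧
      φ (δ * k x) * (h₀ (k x) + 4 * h₁ (k x)) ≤ 1 := fun x hx => by
    have hm := hk.mem_Ioo hδ hx
    have h1 := hφ.2 0 (Nat.zero_le _) _ hm
    have h2 := hanti hm.1 hx (by nlinarith)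
    have h3 := hφpos _ hm
    have h4 : (δ * k x) ^ 2 ≤ 1 := by
      have := hk.lt_one x
      have : δ * k x ≤ 1 := by nlinarith
      exact pow_le_one₀ hm.1.le this
    rw [iteratedDeriv_zero, abs_of_pos h3] at h1
    simp only at h1 h2
    exact ⟨h3, by nlinarith⟩
  refine ⟨flatMul k (fun _ => 1) δ φ, DefMap.flatMul hkd (by fun_prop) δ hφd,
    hb₀ δ hδ hδ1 φ (hφ.mono le_rfl fun t ht => by linarith [hp₁ t ht]),
    fun x => ?_, fun x => ?_, fun x => ?_, fun a ha b hb hab hne => ?_⟩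
  · unfold flatMul
    split_ifs with hx
    · linarith [(hbound x hx).1]
    · exact le_rfl
  · unfold flatMul
    split_ifs with hx
    · have := hbound x hx
      nlinarith [hp₀ _ hx, hp₁ _ hx]
    · exact zero_le_one
  · unfold flatMul
    split_ifs with hx
    · simp [(hbound x hx).1.ne', hx.ne']
    · simpa using le_antisymm (not_lt.1 hx) (hk.nonneg x)
  · unfold flatMul
    split_ifs with hx
    · have h1 := hbound a hx
      have h2 := hb₁ (a, b) ⟨ha, hb, hab, hne⟩ hx
      simp only at h2
      have h3 : 0 < ‖a - b‖ := norm_pos_iff.2 (sub_ne_zero.2 hne)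
      have h4 : 1 ≤ h₁ (k a) * ‖a - b‖ := by
        rwa [inv_le_iff_one_le_mul₀ h3] at h2
      have h5 : φ (δ * k a) * (4 * h₁ (k a)) ≤ 1 := by nlinarith [hp₀ _ hx]
      nlinarith
    · simp

end Tube

section TubeFunction

variable {n d : ℕ}

/-- The point `p` lies in the vertical disc of radius `ε a` around `a ∈ C`. -/
def InTube (C : Set (Fin n → ℝ)) (τ : Fin d → Fin n) (ε : (Fin n → ℝ) → ℝ)
    (p a : Fin n → ℝ) : Prop :=
  a ∈ C ∧ coordProj d τ a = coordProj d τ p ∧ ∑ i, (p i - a i) ^ 2 < ε a ^ 2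

open Classical in
/-- A function vanishing exactly on `C` and equal to `1` outside a tube around `C`. -/
noncomputable def tubeFun (r : ℕ) (C : Set (Fin n → ℝ)) (τ : Fin d → Fin n)
    (ε : (Fin n → ℝ) → ℝ) (p : Fin n → ℝ) : ℝ :=
  if ∃ a, InTube C τ ε p a then
    1 - (1 - (∑ i, (p i - uniqueChoice (InTube C τ ε p) 0 i) ^ 2) /
      ε (uniqueChoice (InTube C τ ε p) 0) ^ 2) ^ (r + 1)
  else 1

variable {r : ℕ} {C : Set (Fin n → ℝ)} {τ : Fin d → Fin n} {ε : (Fin n → ℝ) → ℝ}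
  {p a b c : Fin n → ℝ}

theorem norm_sub_le_of_sum_sq_le (hε : 0 ≤ ε a) (h : ∑ i, (p i - a i) ^ 2 ≤ ε a ^ 2) :
    ‖p - a‖ ≤ ε a := by
  have := sq_norm_le_sum_sq (p - a)
  simp only [Pi.sub_apply] at this
  exact abs_le_of_sq_le_sq' (this.trans h) hε |>.2

section

variable (hε : ∀ x, 0 ≤ ε x)
  (hsep : ∀ a ∈ C, ∀ b ∈ C, coordProj d τ a = coordProj d τ b → a ≠ b → 4 * ε a ≤ ‖a - b‖)

include hε hsep

theorem InTube.eq_of_norm_lt (hc : InTube C τ ε p c) (hb : b ∈ C)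
    (hbp : coordProj d τ b = coordProj d τ p) (hpb : ‖p - b‖ < 2 * ε b) : c = b := by
  by_contra hne
  have h1 := hsep c hc.1 b hb (hc.2.1.trans hbp.symm) hne
  have h2 := hsep b hb c hc.1 (hbp.trans hc.2.1.symm) (Ne.symm hne)
  have h3 := norm_sub_le_of_sum_sq_le (hε c) hc.2.2.le
  have h4 : ‖c - b‖ ≤ ‖c - p‖ + ‖p - b‖ := norm_sub_le_norm_sub_add_norm_sub c p b
  rw [norm_sub_rev b c] at h2
  rw [norm_sub_rev c p] at h4
  linarith [norm_nonneg (c - b)]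

theorem InTube.eq (hc : InTube C τ ε p c) (hb : InTube C τ ε p b) : c = b := by
  have h1 := norm_sub_le_of_sum_sq_le (hε b) hb.2.2.le
  refine hc.eq_of_norm_lt hε hsep hb.1 hb.2.1 (h1.trans_lt ?_)
  have : 0 < ε b := by
    refine (hε b).lt_of_ne fun h => ?_
    have h2 := hb.2.2
    rw [← h] at h2
    have := Finset.sum_nonneg (fun i (_ : i ∈ Finset.univ) => sq_nonneg (p i - b i))
    linarith
  linarith

theorem InTube.tubeFun_eq (ha : InTube C τ ε p a) :
    tubeFun r C τ ε p = 1 - (1 - (∑ i, (p i - a i) ^ 2) / ε a ^ 2) ^ (r + 1) := by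
  rw [tubeFun, if_pos ⟨a, ha⟩, uniqueChoice_eq ha fun z hz => hz.eq hε hsep ha]

theorem tubeFun_eq_max (hb : b ∈ C) (hbp : coordProj d τ b = coordProj d τ p)
    (hpb : ‖p - b‖ < 2 * ε b) :
    tubeFun r C τ ε p =
      1 - max 0 (1 - (∑ i, (p i - b i) ^ 2) / ε b ^ 2) ^ (r + 1) := by
  have hεb : 0 < ε b := by linarith [norm_nonneg (p - b)]
  by_cases h : ∑ i, (p i - b i) ^ 2 < ε b ^ 2
  · have hb' : InTube C τ ε p b := ⟨hb, hbp, h⟩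
    rw [hb'.tubeFun_eq hε hsep, max_eq_right]
    rw [sub_nonneg, div_le_one (by positivity)]
    exact h.le
  · rw [tubeFun, if_neg, max_eq_left]
    · simp
    · rw [sub_nonpos, one_le_div (by positivity)]
      exact not_lt.1 h
    · rintro ⟨c, hc⟩
      have := hc.eq_of_norm_lt hε hsep hb hbp hpb
      subst this
      exact h hc.2.2

theorem tubeFun_eq_zero_iff (hp : ε p ≠ 0) : tubeFun r C τ ε p = 0 ↔ p ∈ C := by
  constructor
  · intro h
    by_cases hex : ∃ a, InTube C τ ε p a
    · obtain ⟨a, ha⟩ := hex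
      rw [ha.tubeFun_eq hε hsep] at h
      have h0 : 0 ≤ ∑ i, (p i - a i) ^ 2 := Finset.sum_nonneg fun i _ => sq_nonneg _
      have hεa : 0 < ε a ^ 2 := h0.trans_lt ha.2.2
      have h1 : (∑ i, (p i - a i) ^ 2) / ε a ^ 2 < 1 := (div_lt_one hεa).2 ha.2.2
      have h2 : 1 - (∑ i, (p i - a i) ^ 2) / ε a ^ 2 = 1 :=
        (pow_eq_one_iff_of_nonneg (n := r + 1) (by linarith) (by omega)).1 (by linarith)
      have h3 : ∑ i, (p i - a i) ^ 2 = 0 := by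
        have : (∑ i, (p i - a i) ^ 2) / ε a ^ 2 = 0 := by linarith
        exact (div_eq_zero_iff.1 this).resolve_right hεa.ne'
      have h4 : p = a := funext fun i => by
        have := (Finset.sum_eq_zero_iff_of_nonneg (fun i _ => sq_nonneg _)).1 h3 i
          (Finset.mem_univ i)
        exact sub_eq_zero.1 (pow_eq_zero_iff two_ne_zero |>.1 this)
      exact h4 ▸ ha.1
    · rw [tubeFun, if_neg hex] at h
      exact absurd h one_ne_zero
  · intro h
    have hp' : 0 < ε p := (hε p).lt_of_ne hp.symm
    have : InTube C τ ε p p := ⟨h, rfl, by simpa using pow_pos hp' 2⟩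
    rw [this.tubeFun_eq hε hsep]
    simp

end

theorem isClosed_tube {D : Set (Fin n → ℝ)} (hD : IsClosed D) (hε : Continuous ε)
    (hε0 : ∀ x, 0 ≤ ε x) (hε1 : ∀ x, ε x ≤ 1) :
    IsClosed {p | ∃ a ∈ D, coordProj d τ a = coordProj d τ p ∧
      ∑ i, (p i - a i) ^ 2 ≤ ε a ^ 2} := by
  refine IsSeqClosed.isClosed fun x p hx hxp => ?_
  choose a haD haπ haε using hx
  obtain ⟨R, hR⟩ := hxp.norm.bddAbove_range
  have hbd : ∀ j, a j ∈ Metric.closedBall (0 : Fin n → ℝ) (R + 1) := fun j => by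
    rw [mem_closedBall_zero_iff]
    have h1 := (norm_sub_le_of_sum_sq_le (hε0 _) (haε j)).trans (hε1 _)
    have h2 : ‖x j‖ ≤ R := hR (mem_range_self j)
    have h3 := norm_sub_norm_le (a j) (x j)
    rw [norm_sub_rev] at h3
    linarith
  obtain ⟨b, -, ψ, hψ, hb⟩ := tendsto_subseq_of_bounded Metric.isBounded_closedBall hbd
  have hxψ := hxp.comp hψ.tendsto_atTop
  refine ⟨b, hD.mem_of_tendsto hb (.of_forall fun j => haD _), ?_, ?_⟩
  · refine tendsto_nhds_unique (l := Filter.atTop) (((continuous_coordProj τ).tendsto b).comp hb) ?_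
    refine (((continuous_coordProj τ).tendsto p).comp hxψ).congr fun j => ?_
    exact (haπ _).symm
  · refine le_of_tendsto_of_tendsto' (b := Filter.atTop)
      (f := fun j => ∑ i, (x (ψ j) i - a (ψ j) i) ^ 2)
      (g := fun j => ε (a (ψ j)) ^ 2) ?_ ?_ fun j => haε _
    · refine tendsto_finsetSum _ fun i _ => ((Filter.Tendsto.sub ?_ ?_).pow 2)
      · exact ((continuous_apply i).tendsto p).comp hxψ
      · exact ((continuous_apply i).tendsto b).comp hb
    · exact (((hε.tendsto b).comp hb).pow 2)

theorem contDiffAt_tubeFun (hC : ∀ a ∈ C, LocalGraph r C τ a) {D : Set (Fin n → ℝ)}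
    (hD : IsClosed D) (hCD : C ⊆ D) (hDC : ∀ a ∈ D, ε a ≠ 0 → a ∈ C)
    (hεr : ContDiff ℝ r ε) (hε : ∀ x, 0 ≤ ε x) (hε1 : ∀ x, ε x ≤ 1)
    (hsep : ∀ a ∈ C, ∀ b ∈ C, coordProj d τ a = coordProj d τ b → a ≠ b → 4 * ε a ≤ ‖a - b‖)
    (hp : ε p ≠ 0) : ContDiffAt ℝ r (tubeFun r C τ ε) p := by
  by_cases hmem : p ∈ {p | ∃ a ∈ D, coordProj d τ a = coordProj d τ p ∧
      ∑ i, (p i - a i) ^ 2 ≤ ε a ^ 2}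
  · obtain ⟨a, haD, hap, haε⟩ := hmem
    have ha0 : ε a ≠ 0 := fun h => by
      have h1 := norm_sub_le_of_sum_sq_le (hε a) haε
      rw [h, norm_le_zero_iff, sub_eq_zero] at h1
      exact hp (h1 ▸ h)
    have haC := hDC a haD ha0
    have hapos : 0 < ε a := (hε a).lt_of_ne ha0.symm
    obtain ⟨f, hfr, hfa, hfs, hfC⟩ := hC a haC
    have hev := LocalGraph.eventually_mem hfr.continuousAt hfa hfs hfC
    rw [hap] at hfr hfa hev
    set g : (Fin n → ℝ) → Fin n → ℝ := fun y => f (coordProj d τ y) with hg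
    have hgr : ContDiffAt ℝ r g p := by
      have h1 : ContDiffAt ℝ r (coordProj d τ) p := by
        unfold coordProj
        fun_prop
      exact ContDiffAt.comp p hfr h1
    have hgp : g p = a := hfa
    have hgC : ∀ᶠ y in 𝓝 p, coordProj d τ (g y) = coordProj d τ y ∧ g y ∈ C :=
      (continuous_coordProj τ).continuousAt.eventually hev
    have hεg : ContDiffAt ℝ r (fun y => ε (g y)) p := hεr.contDiffAt.comp p hgr
    have hlt : ∀ᶠ y in 𝓝 p, ‖y - g y‖ < 2 * ε (g y) := by
      refine ContinuousAt.eventually_lt (f := fun y => ‖y - g y‖) (g := fun y => 2 * ε (g y))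
        (continuousAt_id.sub hgr.continuousAt).norm (continuousAt_const.mul hεg.continuousAt) ?_
      have := norm_sub_le_of_sum_sq_le (hε a) haε
      simp only [hgp]
      linarith
    have hcd : ContDiffAt ℝ r (fun y =>
        1 - max 0 (1 - (∑ i, (y i - g y i) ^ 2) / ε (g y) ^ 2) ^ (r + 1)) p := by
      refine contDiffAt_const.sub ((contDiff_max_zero_pow r).contDiffAt.comp p
        (contDiffAt_const.sub (ContDiffAt.div (ContDiffAt.sum fun i _ => ?_) (hεg.pow 2) ?_)))
      · exact ((contDiff_apply ℝ ℝ i).contDiffAt.sub (contDiffAt_pi.1 hgr i)).pow 2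
      · simp only [hgp]
        positivity
    refine hcd.congr_of_eventuallyEq ?_
    filter_upwards [hgC, hlt] with y hy hy'
    exact tubeFun_eq_max hε hsep hy.2 hy.1 hy'
  · have hcl := isClosed_tube (τ := τ) hD hεr.continuous hε hε1
    refine (contDiffAt_const (c := (1 : ℝ))).congr_of_eventuallyEq ?_
    filter_upwards [hcl.isOpen_compl.mem_nhds hmem] with y hy
    refine if_neg fun ⟨a, ha⟩ => hy ⟨a, hCD ha.1, ha.2.1, ha.2.2.le⟩

end TubeFunction

section ZeroSets

variable {L : FirstOrder.Language.{u, v}} [L.Structure ℝ] {n d : ℕ}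
variable [hF : Fact (ExpandsOrderedField L)]

theorem DefMap.tubeFun {C : Set (Fin n → ℝ)} {ε : (Fin n → ℝ) → ℝ} (hC : DefSet L C)
    (hε : DefMap L ε) (r : ℕ) (τ : Fin d → Fin n) : DefMap L (tubeFun r C τ ε) := by
  have hC' : DefPred L fun a => a ∈ C := hC
  have hT : DefPred L fun q : (Fin n → ℝ) × (Fin n → ℝ) => InTube C τ ε q.1 q.2 := by
    unfold InTube
    fun_prop (disch := assumption)
  have hu : DefMap L fun p => Paper.uniqueChoice (InTube C τ ε p) 0 := DefMap.uniqueChoice hT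
  unfold Paper.tubeFun
  have hex : DefPred L fun p => ∃ a, InTube C τ ε p a := hT.exists
  fun_prop

variable [hO : Fact (LocallyOMinimal L)]

/-- If `C` is locally a graph over fixed coordinates, `C ∪ T` is closed and `T` is
the zero set of a definable `C^r` function, then so is `C ∪ T`. -/
theorem exists_contDiff_zero_iff_of_localGraph {r : ℕ} {C T : Set (Fin n → ℝ)}
    {τ : Fin d → Fin n} (hCd : DefSet L C) (hC : ∀ a ∈ C, LocalGraph r C τ a)
    (hCT : IsClosed (C ∪ T)) {k : (Fin n → ℝ) → ℝ}
    (hkd : DefMap L k) (hkr : ContDiff ℝ r k) (hk : ∀ x, k x = 0 ↔ x ∈ T) :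
    ∃ F : (Fin n → ℝ) → ℝ, DefMap L F ∧ ContDiff ℝ r F ∧ ∀ x, F x = 0 ↔ x ∈ C ∪ T := by
  obtain ⟨k', hk', hkk'⟩ := exists_isGauge hkd hkr
  have hk0 : ∀ x, k' x = 0 ↔ x ∈ T := fun x => (hkk' x).trans (hk x)
  obtain ⟨ε, hεd, hεr, hε0, hε1, hε, hsep⟩ := exists_radius hCd hC hk' fun t ht => by
    have : {a | a ∈ C ∧ t ≤ k' a} = (C ∪ T) ∩ {a | t ≤ k' a} := by
      ext a
      refine ⟨fun h => ⟨Or.inl h.1, h.2⟩, fun h => ⟨h.1.resolve_right fun hT => ?_, h.2⟩⟩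
      have h1 : t ≤ k' a := h.2
      rw [(hk0 a).2 hT] at h1
      linarith
    rw [this]
    exact hCT.inter (isClosed_le continuous_const hk'.contDiff.continuous)
  have hεT : ∀ x, ε x = 0 ↔ x ∈ T := fun x => (hε x).trans (hk0 x)
  have hG : ∀ x, 0 < k' x → ContDiffAt ℝ r (tubeFun r C τ ε) x := fun x hx =>
    contDiffAt_tubeFun hC hCT subset_union_left
      (fun a ha ha0 => ha.resolve_right fun hT => ha0 ((hεT a).2 hT))
      hεr hε0 hε1 hsep fun h => hx.ne' ((hε x).1 h)
  have hGd : DefMap L (tubeFun r C τ ε) := DefMap.tubeFun hCd hεd r τ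
  obtain ⟨h, hd, ha, hp, hc⟩ := exists_contDiff_flatMul r hk' hGd hG
  obtain ⟨δ, hδ, hδ1, φ, hφd, hφpos, hφ⟩ := exists_flat hd ha hp r
  refine ⟨flatMul k' (tubeFun r C τ ε) δ φ, DefMap.flatMul hk'.defMap hGd δ hφd,
    hc δ hδ hδ1 φ hφ, fun x => ?_⟩
  unfold flatMul
  split_ifs with hx
  · have hxT : x ∉ T := fun h => hx.ne' ((hk0 x).2 h)
    rw [mul_eq_zero, or_iff_right (hφpos _ (hk'.mem_Ioo hδ hx)).ne',
      tubeFun_eq_zero_iff hε0 hsep fun h => hxT ((hεT x).1 h)]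
    exact ⟨Or.inl, fun h => h.resolve_right hxT⟩
  · refine iff_of_true rfl (Or.inr ((hk0 x).1 (le_antisymm (not_lt.1 hx) (hk'.nonneg x))))

end ZeroSets

section Stratification

variable {n d r : ℕ} {A : Set (Fin n → ℝ)} {τ : Fin d → Fin n} {a : Fin n → ℝ}

/-- The local inverse of a coordinate projection of `A` near `a`. -/
noncomputable def localSection (A : Set (Fin n → ℝ)) (τ : Fin d → Fin n) (a : Fin n → ℝ) (δ : ℝ)
    (x : Fin d → ℝ) : Fin n → ℝ :=
  uniqueChoice (fun z => z ∈ A ∧ ‖z - a‖ < δ ∧ coordProj d τ z = x) 0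

theorem localGraph_iff_localSection : LocalGraph r A τ a ↔ ∃ δ : ℝ, 0 < δ ∧
    (∀ i, ContDiffAt ℝ r (fun x => localSection A τ a δ x i) (coordProj d τ a)) ∧
    localSection A τ a δ (coordProj d τ a) = a ∧
    (∀ᶠ x in 𝓝 (coordProj d τ a), coordProj d τ (localSection A τ a δ x) = x) ∧
    ∀ᶠ z in 𝓝 a, (z ∈ A ↔ z = localSection A τ a δ (coordProj d τ z)) := by
  constructor
  · rintro ⟨f, hfr, hfa, hfs, hfA⟩
    obtain ⟨δ, hδ, hball⟩ := Metric.eventually_nhds_iff_ball.1 hfA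
    have hmem := LocalGraph.eventually_mem hfr.continuousAt hfa hfs hfA
    have hnear : ∀ᶠ x in 𝓝 (coordProj d τ a), f x ∈ Metric.ball a δ :=
      hfr.continuousAt.eventually (by
        rw [hfa]
        exact Metric.ball_mem_nhds a hδ)
    have heq : localSection A τ a δ =ᶠ[𝓝 (coordProj d τ a)] f := by
      filter_upwards [hmem, hnear] with x hx hxb
      refine uniqueChoice_eq ⟨hx.2, by rwa [← dist_eq_norm], hx.1⟩ fun z hz => ?_
      rw [(hball z (by rw [Metric.mem_ball, dist_eq_norm]; exact hz.2.1)).1 hz.1, hz.2.2]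
    refine ⟨δ, hδ, contDiffAt_pi.1 (hfr.congr_of_eventuallyEq heq),
      heq.eq_of_nhds.trans hfa, ?_, ?_⟩
    · filter_upwards [heq, hfs] with x h1 h2
      rw [h1, h2]
    · filter_upwards [(continuous_coordProj τ).continuousAt.eventually heq, hfA] with z h1 h2
      rw [h2, h1]
  · rintro ⟨δ, -, h1, h2, h3, h4⟩
    exact ⟨_, contDiffAt_pi.2 h1, h2, h3, h4⟩

theorem LocalGraph.eventually (h : LocalGraph r A τ a) :
    ∀ᶠ b in 𝓝 a, b ∈ A → LocalGraph r A τ b := by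
  obtain ⟨f, hfr, -, hfs, hfA⟩ := h
  have hc := (continuous_coordProj τ).continuousAt (x := a)
  filter_upwards [hc.eventually (hfr.eventually (by simp)), hc.eventually hfs.eventually_nhds,
    hfA.eventually_nhds] with b h1 h2 h3 hb
  exact ⟨f, h1, (h3.self_of_nhds.1 hb).symm, h2, h3⟩

theorem isClosed_diff_localGraph (hA : IsClosed A) (τ : Fin d → Fin n) :
    IsClosed {a | a ∈ A ∧ ¬ LocalGraph r A τ a} := by
  rw [← isOpen_compl_iff, isOpen_iff_mem_nhds]
  intro a ha
  by_cases haA : a ∈ A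
  · have h : LocalGraph r A τ a := by
      by_contra hn
      exact ha ⟨haA, hn⟩
    filter_upwards [h.eventually] with b hb hb'
    exact hb'.2 (hb hb'.1)
  · filter_upwards [hA.isOpen_compl.mem_nhds haA] with b hb hb'
    exact hb hb'.1

theorem LocalGraph.inter (h : LocalGraph r A τ a) :
    LocalGraph r {a | a ∈ A ∧ LocalGraph r A τ a} τ a := by
  have hev := h.eventually
  obtain ⟨f, hfr, hfa, hfs, hfA⟩ := h
  refine ⟨f, hfr, hfa, hfs, ?_⟩
  filter_upwards [hev, hfA] with z h1 h2
  rw [← h2]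
  exact ⟨fun h => h.1, fun h => ⟨h, h1 h⟩⟩

variable {L : FirstOrder.Language.{u, v}} [L.Structure ℝ]
variable [hF : Fact (ExpandsOrderedField L)]

theorem DefPred.localGraph (hA : DefSet L A) (r : ℕ) (τ : Fin d → Fin n) :
    DefPred L fun a => LocalGraph r A τ a := by
  have hA' : DefPred L fun a => a ∈ A := hA
  have hs : DefMap L fun q : ((Fin n → ℝ) × ℝ) × (Fin d → ℝ) =>
      localSection A τ q.1.1 q.1.2 q.2 := by
    refine DefMap.uniqueChoice (P := fun (q : ((Fin n → ℝ) × ℝ) × (Fin d → ℝ)) z =>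
      z ∈ A ∧ ‖z - q.1.1‖ < q.1.2 ∧ coordProj d τ z = q.2) ?_
    unfold DefSet
    simp only [mem_ofPred_eq]
    fun_prop (disch := assumption)
  have hs' {Z : Type} [RealTuple Z] {f : Z → Fin n → ℝ} {g : Z → ℝ} {h : Z → Fin d → ℝ}
      (hf : DefMap L f) (hg : DefMap L g) (hh : DefMap L h) :
      DefMap L fun z => localSection A τ (f z) (g z) (h z) :=
    hs.comp (f := fun z => ((f z, g z), h z)) (by fun_prop)
  refine DefPred.congr (fun a => localGraph_iff_localSection.symm) (DefPred.exists ?_)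
  refine .and (by fun_prop) (.and (DefPred.forall_finite fun i => ?_) (.and ?_ (.and ?_ ?_)))
  · exact (DefPred.contDiffAt (f := fun (q : (Fin n → ℝ) × ℝ) x => localSection A τ q.1 q.2 x i)
      (by fun_prop) r).comp (f := fun q : (Fin n → ℝ) × ℝ => (q, coordProj d τ q.1)) (by fun_prop)
  · exact DefPred.eq (hs' (by fun_prop) (by fun_prop) (by fun_prop)) (by fun_prop)
  · refine DefPred.eventually (P := fun (q : (Fin n → ℝ) × ℝ) x =>
      coordProj d τ (localSection A τ q.1 q.2 x) = x) ?_ (by fun_prop)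
    exact DefPred.eq (DefMap.coordProj (hs' (by fun_prop) (by fun_prop) (by fun_prop)) τ)
      (by fun_prop)
  · refine DefPred.eventually (P := fun (q : (Fin n → ℝ) × ℝ) z =>
      (z ∈ A ↔ z = localSection A τ q.1 q.2 (coordProj d τ z))) (.iff ?_ ?_) (by fun_prop)
    · fun_prop (disch := assumption)
    · exact DefPred.eq (by fun_prop) (hs' (by fun_prop) (by fun_prop) (by fun_prop))

variable [hO : Fact (LocallyOMinimal L)]

theorem Small.exists_localGraph {T : Set (Fin n → ℝ)} (hA : DefSet L A)
    (hs : Small (d + 1) A) (hT : DefSet L T) (hTA : T ⊆ A) (τ : Fin d → Fin n)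
    (hTint : (interior (coordProj d τ '' T)).Nonempty) (r : ℕ) :
    ∃ a ∈ T, LocalGraph r A τ a ∧ ∀ᶠ z in 𝓝 a, z ∈ A → z ∈ T := by
  obtain ⟨V, hV, ⟨x, hx⟩, Q, hQ, f, hf⟩ := hs.exists_section hA hT hTA τ hTint r
  obtain ⟨hfr, hfT, hfQ, hfx, -⟩ := hf x hx
  have hev : ∀ᶠ z in 𝓝 (f x), z ∈ Q ∧ coordProj d τ z ∈ V :=
    Filter.Eventually.and (hQ.mem_nhds hfQ) ((continuous_coordProj τ).continuousAt.eventually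
      (by rw [hfx]; exact hV.mem_nhds hx))
  refine ⟨f x, hfT, ⟨f, by rwa [hfx], by rw [hfx], ?_, ?_⟩, ?_⟩
  · rw [hfx]
    filter_upwards [hV.mem_nhds hx] with y hy using (hf y hy).2.2.2.1
  · filter_upwards [hev] with z hz
    refine ⟨fun hzA => (hf _ hz.2).2.2.2.2 z hzA hz.1 rfl, fun h => ?_⟩
    rw [h]
    exact hTA (hf _ hz.2).2.1
  · filter_upwards [hev] with z hz hzA
    rw [(hf _ hz.2).2.2.2.2 z hzA hz.1 rfl]
    exact (hf _ hz.2).2.1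

theorem exists_contDiff_zero_iff_of_small (r d : ℕ) (hA : DefSet L A) (hcl : IsClosed A)
    (hs : Small d A) :
    ∃ F : (Fin n → ℝ) → ℝ, DefMap L F ∧ ContDiff ℝ r F ∧ ∀ x, F x = 0 ↔ x ∈ A := by
  induction d generalizing A with
  | zero =>
    refine ⟨fun _ => 1, by fun_prop, contDiff_const, fun x => ?_⟩
    simp [eq_empty_of_small_zero hs]
  | succ d ih =>
    set C : (Fin d → Fin n) → Set (Fin n → ℝ) := fun σ => {a | a ∈ A ∧ LocalGraph r A σ a} with hC
    set N : (Fin d → Fin n) → Set (Fin n → ℝ) := fun σ => {a | a ∈ A ∧ ¬ LocalGraph r A σ a} with hN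
    have hCd : ∀ σ, DefSet L (C σ) := fun σ => DefPred.and hA (DefPred.localGraph hA r σ)
    have hNd : ∀ σ, DefSet L (N σ) := fun σ => DefPred.and hA (DefPred.localGraph hA r σ).not
    have hNcl : ∀ σ, IsClosed (N σ) := fun σ => isClosed_diff_localGraph hcl σ
    have hCA : ∀ σ, closure (C σ) ⊆ A := fun σ => closure_minimal (fun a ha => ha.1) hcl
    have hunion : ∀ σ, C σ ∪ (closure (C σ) ∩ N σ) = closure (C σ) := fun σ => by
      ext a
      constructor
      · rintro (h | h)
        exacts [subset_closure h, h.1]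
      · intro h
        by_cases ha : LocalGraph r A σ a
        · exact Or.inl ⟨hCA σ h, ha⟩
        · exact Or.inr ⟨h, hCA σ h, ha⟩
    have hstep : ∀ σ, ∃ F : (Fin n → ℝ) → ℝ, DefMap L F ∧ ContDiff ℝ r F ∧
        ∀ x, F x = 0 ↔ x ∈ closure (C σ) := by
      intro σ
      have hTd : DefSet L (closure (C σ) ∩ N σ) := (DefSet.closure (hCd σ)).inter (hNd σ)
      obtain ⟨k, hkd, hkr, hk⟩ := ih hTd (isClosed_closure.inter (hNcl σ)) fun τ => by
        by_contra hne
        obtain ⟨a, ha, -, hev⟩ := hs.exists_localGraph hA hTd (fun a ha => ha.2.1) τ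
          (nonempty_iff_ne_empty.2 hne) 0
        obtain ⟨z, hz, hzC⟩ := mem_closure_iff_nhds.1 ha.1 _ hev
        exact (hz hzC.1).2.2 hzC.2
      rw [← hunion σ]
      refine exists_contDiff_zero_iff_of_localGraph (hCd σ) (fun a ha => ha.2.inter) ?_ hkd hkr hk
      rw [hunion]
      exact isClosed_closure
    have hEd : DefSet L {a | a ∈ A ∧ ∀ σ : Fin d → Fin n, ¬ LocalGraph r A σ a} :=
      DefPred.and hA (DefPred.forall_finite fun σ => (DefPred.localGraph hA r σ).not)
    have hEcl : IsClosed {a | a ∈ A ∧ ∀ σ : Fin d → Fin n, ¬ LocalGraph r A σ a} := by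
      have : {a | a ∈ A ∧ ∀ σ : Fin d → Fin n, ¬ LocalGraph r A σ a} = A ∩ ⋂ σ, N σ := by
        ext a
        simp only [hN, mem_ofPred_eq, mem_inter_iff, mem_iInter]
        exact ⟨fun h => ⟨h.1, fun σ => ⟨h.1, h.2 σ⟩⟩, fun h => ⟨h.1, fun σ => (h.2 σ).2⟩⟩
      rw [this]
      exact hcl.inter (isClosed_iInter hNcl)
    obtain ⟨k, hkd, hkr, hk⟩ := ih hEd hEcl fun τ => by
      by_contra hne
      obtain ⟨a, ha, hLG, -⟩ := hs.exists_localGraph hA hEd (fun a ha => ha.1) τ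
        (nonempty_iff_ne_empty.2 hne) r
      exact ha.2 τ hLG
    choose F hFd hFr hF0 using hstep
    refine ⟨fun x => k x * ∏ σ, F σ x, by fun_prop, hkr.mul (contDiff_prod fun σ _ => hFr σ),
      fun x => ?_⟩
    rw [mul_eq_zero, hk, Finset.prod_eq_zero_iff]
    constructor
    · rintro (h | ⟨σ, -, h⟩)
      · exact h.1
      · exact hCA σ ((hF0 σ x).1 h)
    · intro hx
      by_cases h : ∀ σ : Fin d → Fin n, ¬ LocalGraph r A σ x
      · exact Or.inl ⟨hx, h⟩
      · push Not at h
        obtain ⟨σ, hσ⟩ := h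
        exact Or.inr ⟨σ, Finset.mem_univ σ, (hF0 σ x).2 (subset_closure ⟨hx, hσ⟩)⟩

omit hF hO in
/-- A definable map `ℝⁿ → ℝ` has definable graph. -/
theorem DefMap.defFunOn {f : (Fin n → ℝ) → ℝ} (hf : DefMap L f) : DefFunOn L n univ f := by
  refine def_iff_defSet.2 ?_
  have hfst : DefMap L fun z : Fin (n + 1) → ℝ => fstFun (m := n) (n := 1) z := by
    unfold fstFun
    fun_prop
  have h : DefPred L fun z : Fin (n + 1) → ℝ => z (Fin.natAdd n 0) = f (fstFun z) := by fun_prop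
  refine h.congr fun z => ?_
  simp only [mem_ofPred_eq, mem_univ, true_and, sndFun, funext_iff]
  exact ⟨fun h j => by rwa [Subsingleton.elim j 0], fun h => h 0⟩

end Stratification

end Paper

namespace Paper

variable (L : FirstOrder.Language) [L.Structure ℝ]

/-- every definable closed subset of `ℝⁿ` is the zero set of a definable
`C^r` function. -/
theorem statement15
    (hfield : ExpandsOrderedField L) (hlom : LocallyOMinimal L)
    (r n : ℕ) (A : Set (Fin n → ℝ)) (hAdef : Def L n A) (hAclosed : IsClosed A) :
    ∃ f : (Fin n → ℝ) → ℝ, DefFunOn L n Set.univ f ∧ ContDiff ℝ r f ∧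
      f ⁻¹' {0} = A := by
  have := Fact.mk hfield
  have := Fact.mk hlom
  obtain ⟨F, hFd, hFr, hF0⟩ := exists_contDiff_zero_iff_of_small r (n + 1)
    (def_iff_defSet.1 hAdef) hAclosed (small_succ_self A)
  exact ⟨F, hFd.defFunOn, hFr, Set.ext fun x => hF0 x⟩

end Paper
end

section
/- Let M be a definably complete expansion of a dense linear order without endpoints, and let X ⊆ M^n be a definable set that is closed and bounded (contained in a closed box). Let {S_t}_{t∈T} be a definable family of nonempty definable closed subsets of X (T a definable set, and ⋃_{t∈T} {t} × S_t definable) which is a filtered collection: for all t₁, t₂ ∈ T there exists t₃ ∈ T with S_{t₃} ⊆ S_{t₁} ∩ S_{t₂}. Then ⋂_{t∈T} S_t ≠ ∅. -/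
open FirstOrder Set Topology

namespace Paper16

variable {M : Type*} (L : FirstOrder.Language) [L.Structure M] [LinearOrder M]

/-- A subset of `M^n` is definable in the structure (with parameters from `M`). -/
def Def (n : ℕ) (s : Set (Fin n → M)) : Prop :=
  Set.Definable (Set.univ : Set M) L s

/-- A subset of `M` is definable. -/
def Def1 (s : Set M) : Prop := Def L 1 {x | x 0 ∈ s}

/-- Definable completeness: every nonempty definable subset of `M` which is bounded above
(resp. below) has a least upper bound (resp. greatest lower bound) in `M`; equivalently,
every definable subset of `M` has a supremum and an infimum in `M ∪ {±∞}`. -/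
def DefinablyComplete : Prop :=
  (∀ s : Set M, Def1 L s → s.Nonempty → BddAbove s → ∃ a, IsLUB s a) ∧
  (∀ s : Set M, Def1 L s → s.Nonempty → BddBelow s → ∃ a, IsGLB s a)

/-- First component of a point of `M^(m+n) = M^m × M^n`. -/
def fstFun {m n : ℕ} (z : Fin (m + n) → M) : Fin m → M := fun i => z (Fin.castAdd n i)

/-- Second component of a point of `M^(m+n) = M^m × M^n`. -/
def sndFun {m n : ℕ} (z : Fin (m + n) → M) : Fin n → M := fun j => z (Fin.natAdd m j)

section Definability

variable {L} {N : Type*} [L.Structure N] {α β : Type}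

/-- Existential quantification preserves definability. -/
theorem definable_exists [Finite α] [Finite β] {A : Set (α ⊕ β → N)}
    (hA : (univ : Set N).Definable L A) :
    (univ : Set N).Definable L {w : α → N | ∃ x : β → N, Sum.elim w x ∈ A} := by
  convert hA.image_comp (Sum.inl : α → α ⊕ β) using 1
  ext w
  constructor
  · rintro ⟨x, hx⟩
    exact ⟨_, hx, Sum.elim_comp_inl w x⟩
  · rintro ⟨g, hg, rfl⟩
    exact ⟨g ∘ Sum.inr, by simpa using hg⟩

/-- Universal quantification preserves definability. -/
theorem definable_forall [Finite α] [Finite β] {A : Set (α ⊕ β → N)}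
    (hA : (univ : Set N).Definable L A) :
    (univ : Set N).Definable L {w : α → N | ∀ x : β → N, Sum.elim w x ∈ A} := by
  convert (definable_exists hA.compl).compl using 1
  ext w
  simp

theorem definable_imp {A B : Set (α → N)} (hA : (univ : Set N).Definable L A)
    (hB : (univ : Set N).Definable L B) :
    (univ : Set N).Definable L {w : α → N | w ∈ A → w ∈ B} := by
  convert hA.compl.union hB using 1
  ext w
  simp [imp_iff_not_or]

theorem definable_coord_eq (i : α) (y : N) :
    (univ : Set N).Definable L {w : α → N | w i = y} :=
  (Set.Definable.singleton_of_mem L (mem_univ y)).preimage_comp fun _ => i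

theorem definable_coord_lt (hlt : Def L 2 {x : Fin 2 → M | x 0 < x 1}) (i j : α) :
    (univ : Set M).Definable L {w : α → M | w i < w j} := by
  simpa using hlt.preimage_comp ![i, j]

end Definability

/-- A filter on `M^ι` is definable if, for every definable family of subsets of `M^ι`, the set of
parameters of the members that belong to the filter is definable. -/
def DefFilter {ι : Type} (F : Filter (ι → M)) : Prop :=
  ∀ (β : Type) [Finite β] (A : Set (β ⊕ ι → M)), (univ : Set M).Definable L A →
    (univ : Set M).Definable L {w : β → M | ∀ᶠ x in F, Sum.elim w x ∈ A}

section Filters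

variable {L} {N : Type*} [L.Structure N] {ι : Type}

/-- The filter generated by a definable filtered family of sets is definable. -/
theorem DefFilter.of_hasBasis [Finite ι] {κ : Type} [Finite κ] {F : Filter (ι → N)}
    {T : Set (κ → N)} {S : (κ → N) → Set (ι → N)} (hF : F.HasBasis (· ∈ T) S)
    (hT : (univ : Set N).Definable L T)
    (hS : (univ : Set N).Definable L {z : κ ⊕ ι → N | z ∘ Sum.inl ∈ T ∧
      z ∘ Sum.inr ∈ S (z ∘ Sum.inl)}) :
    DefFilter L F := by
  intro β _ A hA
  have h := definable_exists ((hT.preimage_comp (Sum.inr : κ → β ⊕ κ)).inter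
    (definable_forall (definable_imp (hS.preimage_comp (Sum.map (Sum.inr : κ → β ⊕ κ) (id : ι → ι)))
      (hA.preimage_comp (Sum.map (Sum.inl : β → β ⊕ κ) (id : ι → ι))))))
  convert h using 1
  ext w
  simp only [mem_ofPred_eq, hF.eventually_iff, mem_inter_iff, mem_preimage, Sum.elim_comp_inr,
    Sum.elim_comp_map, Sum.elim_comp_inl, Function.comp_id]
  exact exists_congr fun t => and_congr_right fun ht => by simp [ht]

/-- Restricting a definable filter to the neighbourhoods of a value of one coordinate gives a
definable filter. -/
theorem DefFilter.inf_comap_nhds [NoMinOrder M] [NoMaxOrder M]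
    [TopologicalSpace M] [OrderTopology M] (hlt : Def L 2 {x : Fin 2 → M | x 0 < x 1})
    {F : Filter (ι → M)} (hF : DefFilter L F) (i : ι) (y : M) :
    DefFilter L (F ⊓ (𝓝 y).comap (Function.eval i)) := by
  intro β _ A hA
  have h := definable_exists (((definable_coord_eq (Sum.inr 2 : β ⊕ Fin 3) y).inter
    ((definable_coord_lt hlt (Sum.inr 0 : β ⊕ Fin 3) (Sum.inr 2)).inter
      (definable_coord_lt hlt (Sum.inr 2 : β ⊕ Fin 3) (Sum.inr 1)))).inter
    (hF (β ⊕ Fin 3) _ (definable_imp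
      ((definable_coord_lt hlt (Sum.inl (Sum.inr 0) : (β ⊕ Fin 3) ⊕ ι) (Sum.inr i)).inter
        (definable_coord_lt hlt (Sum.inr i : (β ⊕ Fin 3) ⊕ ι) (Sum.inl (Sum.inr 1))))
      (hA.preimage_comp (Sum.map (Sum.inl : β → β ⊕ Fin 3) (id : ι → ι))))))
  convert h using 1
  ext w
  simp only [mem_ofPred_eq, mem_inter_iff, mem_preimage, Sum.elim_inr, Sum.elim_inl,
    Sum.elim_comp_map, Sum.elim_comp_inl, Function.comp_id]
  rw [(F.basis_sets.inf ((nhds_basis_Ioo y).comap (Function.eval i))).eventually_iff]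
  constructor
  · rintro ⟨⟨U, u, v⟩, ⟨hU, hu, hv⟩, h⟩
    refine ⟨![u, v, y], ⟨rfl, hu, hv⟩, ?_⟩
    filter_upwards [hU] with x hx hxi using h ⟨hx, hxi⟩
  · rintro ⟨p, ⟨rfl, hu, hv⟩, hF⟩
    exact ⟨(_, p 0, p 1), ⟨hF, hu, hv⟩, fun x hx => hx.1 hx.2⟩

/-- In a definably complete structure, each coordinate along a bounded proper definable filter has
a cluster point. -/
theorem DefFilter.exists_neBot_inf_comap_nhds [NoMinOrder M] [NoMaxOrder M]
    [TopologicalSpace M] [OrderTopology M] (hlt : Def L 2 {x : Fin 2 → M | x 0 < x 1})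
    (hdc : DefinablyComplete (M := M) L) {F : Filter (ι → M)} [F.NeBot] (hF : DefFilter L F)
    (i : ι) {a b : M} (hab : ∀ᶠ x in F, a ≤ x i ∧ x i ≤ b) :
    ∃ y, (F ⊓ (𝓝 y).comap (Function.eval i)).NeBot := by
  obtain ⟨y, hy⟩ := hdc.2 {w | ∀ᶠ x in F, x i ≤ w}
    (by
      simpa [Def1, Def] using
        hF (Fin 1) _ (definable_coord_lt hlt (Sum.inl 0) (Sum.inr i)).compl)
    ⟨b, hab.mono fun x hx => hx.2⟩
    ⟨a, fun w hw => by
      obtain ⟨x, hx, hxw⟩ := (hab.and hw).exists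
      exact hx.1.trans hxw⟩
  refine ⟨y, ((F.basis_sets.inf_basis_neBot_iff
    ((nhds_basis_Ioo y).comap (Function.eval i))).2 ?_)⟩
  rintro U hU ⟨u, v⟩ ⟨hu, hv⟩
  obtain ⟨w, hw, hwv⟩ := (isGLB_lt_iff hy).1 hv
  have hfu : ∃ᶠ x in F, u < x i := fun h =>
    hu.not_ge (hy.1 (h.mono fun x hx => not_lt.1 hx))
  obtain ⟨x, hxu, hxw, hxU⟩ := (hfu.and_eventually (Filter.Eventually.and hw hU)).exists
  exact ⟨x, hxU, hxu, lt_of_le_of_lt hxw hwv⟩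

/-- In a definably complete structure, a bounded proper definable filter has a cluster point. -/
theorem DefFilter.exists_clusterPt [Finite ι] [NoMinOrder M] [NoMaxOrder M]
    [TopologicalSpace M] [OrderTopology M] (hlt : Def L 2 {x : Fin 2 → M | x 0 < x 1})
    (hdc : DefinablyComplete (M := M) L) {F : Filter (ι → M)} [F.NeBot] (hF : DefFilter L F)
    {a b : ι → M} (hab : ∀ᶠ x in F, ∀ i, a i ≤ x i ∧ x i ≤ b i) :
    ∃ x, ClusterPt x F := by
  classical
  cases nonempty_fintype ι
  have key : ∀ s : Finset ι, ∃ y : ι → M,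
      (F ⊓ ⨅ i ∈ s, (𝓝 (y i)).comap (Function.eval i)).NeBot ∧
        DefFilter L (F ⊓ ⨅ i ∈ s, (𝓝 (y i)).comap (Function.eval i)) := by
    intro s
    induction s using Finset.induction_on with
    | empty => exact ⟨a, by simpa using ⟨‹F.NeBot›, hF⟩⟩
    | insert i s his ih =>
      obtain ⟨y, hne, hdef⟩ := ih
      obtain ⟨c, hc⟩ := hdef.exists_neBot_inf_comap_nhds hlt hdc i
        ((hab.filter_mono inf_le_left).mono fun x hx => hx i)
      have heq : F ⊓ ⨅ j ∈ insert i s, (𝓝 (Function.update y i c j)).comap (Function.eval j) =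
          (F ⊓ ⨅ j ∈ s, (𝓝 (y j)).comap (Function.eval j)) ⊓ (𝓝 c).comap (Function.eval i) := by
        rw [Finset.iInf_insert, Function.update_self, inf_comm ((𝓝 c).comap _), ← inf_assoc]
        congr 2
        refine iInf_congr fun j => iInf_congr fun hj => ?_
        rw [Function.update_of_ne (ne_of_mem_of_not_mem hj his)]
      exact ⟨Function.update y i c, heq ▸ hc, heq ▸ hdef.inf_comap_nhds hlt i c⟩
  obtain ⟨y, hy, -⟩ := key Finset.univ
  refine ⟨y, ?_⟩
  rw [ClusterPt, inf_comm, nhds_pi, Filter.pi]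
  simpa using hy

end Filters

/-- in a definably complete expansion of a dense linear order without
endpoints, every definable filtered collection of nonempty definable closed subsets of a
definable closed bounded set `X ⊆ M^n` has nonempty intersection. -/
theorem statement16
    [DenselyOrdered M] [NoMinOrder M] [NoMaxOrder M] [Nonempty M]
    [TopologicalSpace M] [OrderTopology M]
    (hlt : Def L 2 {x : Fin 2 → M | x 0 < x 1})
    (hdc : DefinablyComplete (M := M) L)
    (n m : ℕ) (X : Set (Fin n → M)) (hXdef : Def L n X)
    (hXclosed : IsClosed X)
    (hXbdd : ∃ a b : Fin n → M, ∀ x ∈ X, ∀ i, a i ≤ x i ∧ x i ≤ b i)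
    (T : Set (Fin m → M)) (hTdef : Def L m T)
    (S : (Fin m → M) → Set (Fin n → M))
    (hfam : Def L (m + n) {z | fstFun z ∈ T ∧ sndFun z ∈ S (fstFun z)})
    (hsub : ∀ t ∈ T, S t ⊆ X)
    (hne : ∀ t ∈ T, (S t).Nonempty)
    (hcl : ∀ t ∈ T, IsClosed (S t))
    (hfil : ∀ t₁ ∈ T, ∀ t₂ ∈ T, ∃ t₃ ∈ T, S t₃ ⊆ S t₁ ∩ S t₂) :
    ∃ x : Fin n → M, ∀ t ∈ T, x ∈ S t := by
  rcases T.eq_empty_or_nonempty with rfl | hT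
  · exact ⟨fun _ => Classical.arbitrary M, by simp⟩
  obtain ⟨a, b, hab⟩ := hXbdd
  have hbasis := Filter.hasBasis_biInf_principal (s := S) (S := T)
    (fun t₁ h₁ t₂ h₂ => by
      obtain ⟨t₃, h₃, h⟩ := hfil t₁ h₁ t₂ h₂
      exact ⟨t₃, h₃, h.trans inter_subset_left, h.trans inter_subset_right⟩) hT
  have hdef := DefFilter.of_hasBasis hbasis hTdef
    (by
      convert hfam.preimage_comp finSumFinEquiv.symm using 1
      ext z
      have hfst : fstFun (z ∘ finSumFinEquiv.symm) = z ∘ Sum.inl := by ext i; simp [fstFun]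
      have hsnd : sndFun (z ∘ finSumFinEquiv.symm) = z ∘ Sum.inr := by ext j; simp [sndFun]
      simp [hfst, hsnd])
  have := hbasis.neBot_iff.2 fun {t} ht => hne t ht
  obtain ⟨t₀, ht₀⟩ := hT
  obtain ⟨x, hx⟩ := hdef.exists_clusterPt hlt hdc (a := a) (b := b)
    (Filter.mem_of_superset (hbasis.mem_of_mem ht₀) fun z hz => hab z (hsub t₀ ht₀ hz))
  exact ⟨x, fun t ht => (hcl t ht).closure_eq ▸ hx.mem_closure_of_mem _ (hbasis.mem_of_mem ht)⟩

end Paper16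
end
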